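/- arXiv:1910.05859 — 3 statements merged into one kernel-verified Lean document; each statement's English description precedes it below -/
import Mathlib

section
/- Let n = n₁ + n₂ − 1 with n₁, n₂ ≥ 1, let x ∈ ℂⁿ be such that L = ℋ(x) has rank r and is μ-incoherent, with singular values σ₁ ≥ ⋯ ≥ σ_r > 0 and condition number κ = σ₁/σ_r, and let s ∈ ℂⁿ be α-sparse. Set τ = 4αμc_s rκ, β = μc_s r/(2κn), fix γ ∈ (1/√12, 1), and let z = x + s. Define iterates for k ≥ 0 by: ζ_{k+1} = β γ^k σ₁(L_k), s_{k+1} = T_{ζ_{k+1}}(z − x_k), L_{k+1} = D_r(P_{T_k} ℋ(z − s_{k+1})) where T_k is the tangent space of L_k and D_r denotes a best rank-r approximation, and x_{k+1} = ℋ†(L_{k+1}). Then there exists a constant c > 0 (depending only on γ) such that if α ≤ c/(μ c_s r κ)², and the initial guess L₀ (of rank r) and x₀ = ℋ†(L₀) satisfy ‖L − L₀‖₂ ≤ 2τσ_r, ‖x − x₀‖_∞ ≤ ((τ − 2τ²)/(8ακn))σ_r, and L₀ is 4μκ²-incoherent, then for every k ≥ 0: ‖L − L_k‖₂ ≤ 2τγ^k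 σ_r, ‖x − x_k‖_∞ ≤ ((τ − 2τ²)/(8ακn))γ^k σ_r, and L_k is 4μκ²-incoherent. -/
open Matrix
open scoped BigOperators

noncomputable section

namespace ASAP

/-- The Hankel operator `ℋ : ℂⁿ → ℂ^{n₁×n₂}`, `[ℋ(x)]_{i,j} = x_{i+j}`. -/
def hankel {n₁ n₂ n : ℕ} (hn : n + 1 = n₁ + n₂) (x : Fin n → ℂ) :
    Matrix (Fin n₁) (Fin n₂) ℂ :=
  Matrix.of fun i j => x ⟨i.1 + j.1, by have hi := i.2; have hj := j.2; omega⟩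

open Classical in
/-- The left inverse `ℋ†` of the Hankel operator: averages over antidiagonals. -/
def hankelDagger {n₁ n₂ n : ℕ} (_hn : n + 1 = n₁ + n₂)
    (M : Matrix (Fin n₁) (Fin n₂) ℂ) : Fin n → ℂ := fun t =>
  (((Finset.univ.filter fun p : Fin n₁ × Fin n₂ => p.1.1 + p.2.1 = t.1).card : ℂ))⁻¹ *
    ∑ p ∈ Finset.univ.filter fun p : Fin n₁ × Fin n₂ => p.1.1 + p.2.1 = t.1, M p.1 p.2

/-- Spectral norm (largest singular value) of a matrix. -/
def specNorm {m n : Type*} [Fintype m] [Fintype n] [DecidableEq n]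
    (M : Matrix m n ℂ) : ℝ :=
  ‖LinearMap.toContinuousLinearMap (Matrix.toEuclideanLin M)‖

/-- Frobenius norm of a matrix. -/
def frobNorm {m n : Type*} [Fintype m] [Fintype n] (M : Matrix m n ℂ) : ℝ :=
  Real.sqrt (∑ i, ∑ j, ‖M i j‖ ^ 2)

/-- `‖·‖_{2,∞}`: maximum ℓ₂ norm of the rows of a matrix. -/
def rowNorm {m n : Type*} [Fintype m] [Fintype n] (M : Matrix m n ℂ) : ℝ :=
  ⨆ i, Real.sqrt (∑ j, ‖M i j‖ ^ 2)

/-- Entrywise max norm of a matrix. -/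
def maxNorm {m n : Type*} [Fintype m] [Fintype n] (M : Matrix m n ℂ) : ℝ :=
  ⨆ i, ⨆ j, ‖M i j‖

/-- ℓ∞ norm of a vector. -/
def vecMaxNorm {n : Type*} [Fintype n] (v : n → ℂ) : ℝ :=
  ⨆ t, ‖v t‖

/-- ℓ₂ norm of a vector. -/
def vecTwoNorm {n : Type*} [Fintype n] (v : n → ℂ) : ℝ :=
  Real.sqrt (∑ t, ‖v t‖ ^ 2)

/-- The augmented Hermitian matrix `[[0, M], [Mᴴ, 0]]`. -/
def aug {m n : Type*} (M : Matrix m n ℂ) : Matrix (m ⊕ n) (m ⊕ n) ℂ :=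
  Matrix.fromBlocks 0 M Mᴴ 0

open Classical in
/-- Support (set of indices of nonzero entries) of a vector. -/
def supp {n : Type*} [Fintype n] (v : n → ℂ) : Finset n :=
  Finset.univ.filter fun t => v t ≠ 0

/-- `α`-sparsity: at most `α·n` nonzero entries. -/
def IsSparse {n : ℕ} (α : ℝ) (s : Fin n → ℂ) : Prop :=
  ((supp s).card : ℝ) ≤ α * n

/-- The hard thresholding operator `T_ζ`. -/
def hardThreshold {n : ℕ} (ζ : ℝ) (v : Fin n → ℂ) : Fin n → ℂ := fun t =>
  if ζ < ‖v t‖ then v t else 0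

/-- `c_s = max {n/n₁, n/n₂}`. -/
def csConst (n₁ n₂ n : ℕ) : ℝ :=
  max ((n : ℝ) / n₁) ((n : ℝ) / n₂)

/-- `(U, σ, V)` is a (compact, rank-`r`, positive and ordered) singular value
decomposition of `L`, i.e. `L = U Σ V*` with orthonormal columns. -/
def IsSVD {m n : Type*} [Fintype m] [Fintype n] {r : ℕ}
    (L : Matrix m n ℂ) (U : Matrix m (Fin r) ℂ) (σ : Fin r → ℝ)
    (V : Matrix n (Fin r) ℂ) : Prop :=
  Uᴴ * U = 1 ∧ Vᴴ * V = 1 ∧ (∀ i, 0 < σ i) ∧ (∀ i j : Fin r, i ≤ j → σ j ≤ σ i) ∧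
    L = U * Matrix.diagonal (fun i => (σ i : ℂ)) * Vᴴ

/-- `μ`-incoherence of a rank-`r` matrix (with respect to `c_s` and `n`). -/
def IsIncoherent {m n' : Type*} [Fintype m] [Fintype n'] (r n : ℕ) (μ cs : ℝ)
    (L : Matrix m n' ℂ) : Prop :=
  ∃ (U : Matrix m (Fin r) ℂ) (σ : Fin r → ℝ) (V : Matrix n' (Fin r) ℂ),
    IsSVD L U σ V ∧ rowNorm U ≤ Real.sqrt (μ * cs * r / n) ∧
      rowNorm V ≤ Real.sqrt (μ * cs * r / n)

/-- Orthogonal projection onto the tangent space determined by `U` and `V`: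
`P_T M = UU*M + MVV* − UU*MVV*`. -/
def tangentProj {m n : Type*} [Fintype m] [Fintype n] {r : ℕ}
    (U : Matrix m (Fin r) ℂ) (V : Matrix n (Fin r) ℂ)
    (M : Matrix m n ℂ) : Matrix m n ℂ :=
  U * Uᴴ * M + M * (V * Vᴴ) - U * Uᴴ * M * (V * Vᴴ)

/-- `L` is a best rank-`r` approximation of `A` with respect to the norm `nrm`. -/
def IsBestApproxWrt {m n : Type*} [Fintype m] [Fintype n] (r : ℕ)
    (nrm : Matrix m n ℂ → ℝ) (A L : Matrix m n ℂ) : Prop :=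
  L.rank ≤ r ∧ ∀ B : Matrix m n ℂ, B.rank ≤ r → nrm (A - L) ≤ nrm (A - B)

/-- Best rank-`r` approximation in Frobenius norm (truncated SVD, `D_r`). -/
def IsBestRankApprox {m n : Type*} [Fintype m] [Fintype n] (r : ℕ)
    (A L : Matrix m n ℂ) : Prop :=
  IsBestApproxWrt r frobNorm A L

/-- Horizontal concatenation of two matrices. -/
def hcat {m a b : Type*} (A : Matrix m a ℂ) (B : Matrix m b ℂ) :
    Matrix m (a ⊕ b) ℂ :=
  Matrix.of fun i => Sum.elim (A i) (B i)


open scoped Matrix.Norms.L2Operator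

set_option linter.unusedSectionVars false

section general

variable {m n l : Type*} [Fintype m] [Fintype n] [Fintype l]
  [DecidableEq m] [DecidableEq n] [DecidableEq l]

lemma specNorm_eq (M : Matrix m n ℂ) : specNorm M = ‖M‖ := rfl

lemma nmul {A : Matrix m n ℂ} {B : Matrix n l ℂ} {a b : ℝ} (hA : ‖A‖ ≤ a) (hB : ‖B‖ ≤ b) :
    ‖A * B‖ ≤ a * b :=
  (Matrix.l2_opNorm_mul A B).trans
    (mul_le_mul hA hB (norm_nonneg _) ((norm_nonneg _).trans hA))

lemma nct (A : Matrix m n ℂ) : ‖Aᴴ‖ = ‖A‖ := Matrix.l2_opNorm_conjTranspose A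

lemma opnorm_le (A : Matrix m n ℂ) {C : ℝ} (hC : 0 ≤ C)
    (h : ∀ x : n → ℂ, ∑ i, ‖(A *ᵥ x) i‖ ^ 2 ≤ C ^ 2 * ∑ j, ‖x j‖ ^ 2) : ‖A‖ ≤ C := by
  rw [Matrix.l2_opNorm_def]
  refine ContinuousLinearMap.opNorm_le_bound _ hC fun x => ?_
  have h1 := h x.ofLp
  rw [EuclideanSpace.norm_eq, EuclideanSpace.norm_eq]
  calc _ ≤ Real.sqrt (C ^ 2 * ∑ j, ‖x.ofLp j‖ ^ 2) := Real.sqrt_le_sqrt h1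
    _ = _ := by rw [Real.sqrt_mul (sq_nonneg C), Real.sqrt_sq hC]

lemma herm_idem_norm {P : Matrix m m ℂ} (h : Pᴴ * P = P) : ‖P‖ ≤ 1 := by
  have h1 := Matrix.l2_opNorm_conjTranspose_mul_self P
  rw [h] at h1
  by_contra hc
  push Not at hc
  nlinarith

lemma norm_one_le : ‖(1 : Matrix m m ℂ)‖ ≤ 1 := herm_idem_norm (by simp)

lemma iso_norm {U : Matrix m n ℂ} (h : Uᴴ * U = 1) : ‖U‖ ≤ 1 := by
  have h1 := Matrix.l2_opNorm_conjTranspose_mul_self U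
  rw [h] at h1
  have := norm_one_le (m := n)
  by_contra hc
  push Not at hc
  nlinarith

/-- Bundled facts about a projection `P = U Uᴴ`. -/
lemma proj_idem {U : Matrix m n ℂ} (h : Uᴴ * U = 1) : (U * Uᴴ) * (U * Uᴴ) = U * Uᴴ := by
  calc (U * Uᴴ) * (U * Uᴴ) = U * (Uᴴ * U) * Uᴴ := by simp only [Matrix.mul_assoc]
    _ = _ := by rw [h, Matrix.mul_one]

lemma proj_herm (U : Matrix m n ℂ) : (U * Uᴴ)ᴴ = U * Uᴴ := by
  simp [Matrix.conjTranspose_mul]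

lemma proj_norm {U : Matrix m n ℂ} (h : Uᴴ * U = 1) : ‖U * Uᴴ‖ ≤ 1 :=
  herm_idem_norm (by rw [proj_herm, proj_idem h])

lemma cproj_norm {U : Matrix m n ℂ} (h : Uᴴ * U = 1) : ‖1 - U * Uᴴ‖ ≤ 1 := by
  apply herm_idem_norm
  rw [Matrix.conjTranspose_sub, proj_herm, Matrix.conjTranspose_one]
  rw [Matrix.sub_mul, Matrix.mul_sub, Matrix.mul_sub, proj_idem h]
  simp

/-- The tangent projection has operator norm at most `√2`. -/
lemma tangent_norm {P : Matrix m m ℂ} {Q : Matrix n n ℂ} (hP : Pᴴ = P) (hPP : P * P = P)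
    (hQ : Qᴴ = Q) (hQn : ‖Q‖ ≤ 1) (hPn : ‖P‖ ≤ 1) (hPn' : ‖1 - P‖ ≤ 1) (Z : Matrix m n ℂ) :
    ‖P * Z + (1 - P) * Z * Q‖ ≤ Real.sqrt 2 * ‖Z‖ := by
  set T := P * Z + (1 - P) * Z * Q with hT
  have hP' : P * (1 - P) = 0 := by rw [Matrix.mul_sub, hPP]; simp
  have hP'' : (1 - P) * P = 0 := by rw [Matrix.sub_mul, hPP]; simp
  have hP3 : (1 - P) * (1 - P) = 1 - P := by rw [Matrix.mul_sub, hP'']; simp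
  have key : Tᴴ * T = Zᴴ * P * Z + Q * Zᴴ * (1 - P) * Z * Q := by
    have : Tᴴ = Zᴴ * P + Q * Zᴴ * (1 - P) := by
      rw [hT]
      simp only [Matrix.conjTranspose_add, Matrix.conjTranspose_mul, Matrix.conjTranspose_sub,
        Matrix.conjTranspose_one, hP, hQ, Matrix.mul_assoc]
    rw [this, hT]
    calc _ = Zᴴ * (P * P) * Z + Zᴴ * (P * (1 - P)) * Z * Q + Q * Zᴴ * ((1 - P) * P) * Z
          + Q * Zᴴ * ((1 - P) * (1 - P)) * Z * Q := by
            simp only [Matrix.mul_add, Matrix.add_mul, Matrix.mul_assoc]; abel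
      _ = _ := by rw [hPP, hP', hP'', hP3]; simp
  have h1 := Matrix.l2_opNorm_conjTranspose_mul_self T
  rw [key] at h1
  have a1 : ‖Zᴴ * P * Z‖ ≤ ‖Z‖ * 1 * ‖Z‖ := nmul (nmul (nct Z).le hPn) le_rfl
  have a2 : ‖Q * Zᴴ * (1 - P) * Z * Q‖ ≤ 1 * ‖Z‖ * 1 * ‖Z‖ * 1 :=
    nmul (nmul (nmul (nmul hQn (nct Z).le) hPn') le_rfl) hQn
  have a3 := norm_add_le (Zᴴ * P * Z) (Q * Zᴴ * (1 - P) * Z * Q)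
  have hsq : ‖T‖ ^ 2 ≤ 2 * ‖Z‖ ^ 2 := by nlinarith
  calc ‖T‖ ≤ Real.sqrt (2 * ‖Z‖ ^ 2) := Real.le_sqrt_of_sq_le hsq
    _ = _ := by rw [Real.sqrt_mul (by norm_num), Real.sqrt_sq (norm_nonneg _)]

/-- Row selector. -/
def er (i : m) : Matrix Unit m ℂ := Matrix.of fun _ j => if j = i then 1 else 0

lemma row_norm_eq (B : Matrix Unit n ℂ) : ‖B‖ = Real.sqrt (∑ j, ‖B () j‖ ^ 2) := by
  have h1 := Matrix.l2_opNorm_conjTranspose_mul_self Bᴴ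
  have h2 : Bᴴᴴ * Bᴴ = Matrix.diagonal (fun _ : Unit => ((∑ j, ‖B () j‖ ^ 2 : ℝ) : ℂ)) := by
    ext i j
    simp only [Matrix.conjTranspose_conjTranspose, Matrix.mul_apply, Matrix.conjTranspose_apply]
    simp [Matrix.diagonal, Complex.mul_conj, Complex.normSq_eq_norm_sq]
  rw [h2, Matrix.l2_opNorm_diagonal, nct] at h1
  have h3 : (0 : ℝ) ≤ ∑ j, ‖B () j‖ ^ 2 := Finset.sum_nonneg fun _ _ => sq_nonneg _
  have h4 : ‖(fun _ : Unit => ((∑ j, ‖B () j‖ ^ 2 : ℝ) : ℂ))‖ = ∑ j, ‖B () j‖ ^ 2 := by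
    rw [pi_norm_const, Complex.norm_real, Real.norm_of_nonneg h3]
  rw [h4] at h1
  rw [h1, Real.sqrt_mul_self (norm_nonneg _)]

lemma er_mul (i : m) (A : Matrix m n ℂ) (u : Unit) (j : n) : (er i * A) u j = A i j := by
  simp [er, Matrix.mul_apply]

lemma er_mul_norm (i : m) (A : Matrix m n ℂ) :
    ‖er i * A‖ = Real.sqrt (∑ j, ‖A i j‖ ^ 2) := by
  rw [row_norm_eq]; simp only [er_mul]

lemma er_norm (i : m) : ‖(er i : Matrix Unit m ℂ)‖ ≤ 1 := by
  rw [row_norm_eq]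
  have : ∀ j, ‖(er i : Matrix Unit m ℂ) () j‖ ^ 2 = if j = i then 1 else 0 := by
    intro j; simp only [er, Matrix.of_apply]; split_ifs <;> simp
  simp [this]

lemma er_entry (i : m) (j : n) (A : Matrix m n ℂ) : ‖er i * A * (er j)ᴴ‖ = ‖A i j‖ := by
  rw [row_norm_eq]
  have : (er i * A * (er j)ᴴ) () () = A i j := by
    rw [Matrix.mul_assoc, er_mul]
    simp [er, Matrix.mul_apply, Matrix.conjTranspose_apply]
  simp [this]

lemma rowNorm_iff (A : Matrix m n ℂ) {b : ℝ} [Nonempty m] :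
    rowNorm A ≤ b ↔ ∀ i : m, ‖er i * A‖ ≤ b := by
  unfold rowNorm
  simp only [er_mul_norm]
  constructor
  · intro h i
    exact (le_ciSup (f := fun i => Real.sqrt (∑ j, ‖A i j‖ ^ 2)) (Set.finite_range _).bddAbove i).trans h
  · intro h
    exact ciSup_le h

/-! Frobenius norm facts -/

lemma frob_nonneg (A : Matrix m n ℂ) : 0 ≤ frobNorm A := Real.sqrt_nonneg _

lemma frob_sq (A : Matrix m n ℂ) : frobNorm A ^ 2 = ∑ i : m, ‖er i * A‖ ^ 2 := by
  unfold frobNorm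
  rw [Real.sq_sqrt (Finset.sum_nonneg fun _ _ => Finset.sum_nonneg fun _ _ => sq_nonneg _)]
  refine Finset.sum_congr rfl fun i _ => ?_
  rw [er_mul_norm, Real.sq_sqrt (Finset.sum_nonneg fun _ _ => sq_nonneg _)]

lemma frob_ct (A : Matrix m n ℂ) : frobNorm Aᴴ = frobNorm A := by
  unfold frobNorm
  rw [Finset.sum_comm]
  simp [Matrix.conjTranspose_apply]

lemma frob_mul_le (A : Matrix m n ℂ) (B : Matrix n l ℂ) : frobNorm (A * B) ≤ frobNorm A * ‖B‖ := by
  apply (sq_le_sq₀ (frob_nonneg _) (mul_nonneg (frob_nonneg _) (norm_nonneg _))).mp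
  rw [mul_pow, frob_sq, frob_sq, Finset.sum_mul]
  refine Finset.sum_le_sum fun i _ => ?_
  rw [← mul_pow, ← Matrix.mul_assoc]
  exact pow_le_pow_left₀ (norm_nonneg _) (Matrix.l2_opNorm_mul _ _) 2

lemma frob_mul_le' (A : Matrix m n ℂ) (B : Matrix n l ℂ) : frobNorm (A * B) ≤ ‖A‖ * frobNorm B := by
  rw [← frob_ct, Matrix.conjTranspose_mul, mul_comm]
  refine (frob_mul_le _ _).trans ?_
  rw [frob_ct, nct]

lemma norm_le_frob (A : Matrix m n ℂ) : ‖A‖ ≤ frobNorm A := by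
  apply opnorm_le _ (frob_nonneg _)
  intro x
  unfold frobNorm
  rw [Real.sq_sqrt (Finset.sum_nonneg fun _ _ => Finset.sum_nonneg fun _ _ => sq_nonneg _),
    Finset.sum_mul]
  refine Finset.sum_le_sum fun i _ => ?_
  have h1 : ‖(A *ᵥ x) i‖ ≤ ∑ j, ‖A i j‖ * ‖x j‖ := by
    simp only [Matrix.mulVec, dotProduct]
    exact (norm_sum_le _ _).trans (by simp)
  exact (pow_le_pow_left₀ (norm_nonneg _) h1 2).trans (Finset.sum_mul_sq_le_sq_mul_sq _ _ _)

lemma frob_trace (A : Matrix m n ℂ) : frobNorm A ^ 2 = (Matrix.trace (Aᴴ * A)).re := by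
  unfold frobNorm
  rw [Real.sq_sqrt (Finset.sum_nonneg fun _ _ => Finset.sum_nonneg fun _ _ => sq_nonneg _),
    Finset.sum_comm]
  simp only [Matrix.trace, Matrix.diag, Matrix.mul_apply, Matrix.conjTranspose_apply, Complex.re_sum]
  refine Finset.sum_congr rfl fun i _ => Finset.sum_congr rfl fun j _ => ?_
  rw [mul_comm]
  simp [Complex.mul_conj, Complex.normSq_eq_norm_sq]
  norm_cast

lemma frob_pyth (A B : Matrix m n ℂ) (h : Aᴴ * B = 0) :
    frobNorm (A + B) ^ 2 = frobNorm A ^ 2 + frobNorm B ^ 2 := by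
  have h' : Bᴴ * A = 0 := by
    have := congrArg Matrix.conjTranspose h
    simpa [Matrix.conjTranspose_mul] using this
  simp only [frob_trace, Matrix.conjTranspose_add, Matrix.mul_add, Matrix.add_mul, h, h']
  simp

lemma frob_eq_zero {A : Matrix m n ℂ} (h : frobNorm A ^ 2 = 0) : A = 0 := by
  have h1 := norm_le_frob A
  have h2 : frobNorm A = 0 := by simpa using h
  rw [h2] at h1
  exact norm_le_zero_iff.mp h1

lemma frob_neg (A : Matrix m n ℂ) : frobNorm (-A) = frobNorm A := by
  simp [frobNorm]

lemma frob_iso {U : Matrix m n ℂ} (h : Uᴴ * U = 1) : frobNorm U ^ 2 = Fintype.card n := by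
  rw [frob_trace, h]; simp

end general

section frobadd

lemma frob_add_le {m n : Type*} [Fintype m] [Fintype n] (A B : Matrix m n ℂ) :
    frobNorm (A + B) ≤ frobNorm A + frobNorm B := by
  have key : ∀ C : Matrix m n ℂ, frobNorm C =
      @norm _ (Matrix.frobeniusNormedAddCommGroup (m := m) (n := n) (α := ℂ)).toNorm C := by
    intro C
    rw [Matrix.frobenius_norm_def, frobNorm, Real.sqrt_eq_rpow]
    norm_cast
  rw [key, key, key]
  let _ := Matrix.frobeniusNormedAddCommGroup (m := m) (n := n) (α := ℂ)
  exact norm_add_le A B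

end frobadd

section core

set_option linter.unusedSectionVars false

variable {m n : Type*} [Fintype m] [Fintype n] [DecidableEq m] [DecidableEq n]

/-- Projection data of a rank-`r` matrix: the projections onto its column and row spaces,
and its pseudo-inverse. -/
structure PD (r : ℕ) (L : Matrix m n ℂ) (P : Matrix m m ℂ) (Q : Matrix n n ℂ)
    (G : Matrix n m ℂ) (S : ℝ) : Prop where
  Ph : Pᴴ = P
  PP : P * P = P
  Qh : Qᴴ = Q
  QQ : Q * Q = Q
  PL : P * L = L
  LQ : L * Q = L
  LG : L * G = P
  GLe : G * L = Q
  Gn : ‖G‖ ≤ 1 / S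
  fP : frobNorm P ≤ r
  fQ : frobNorm Q ≤ r

lemma PD.ct {r : ℕ} {L : Matrix m n ℂ} {P Q G S} (h : PD r L P Q G S) : PD r Lᴴ Q P Gᴴ S where
  Ph := h.Qh
  PP := h.QQ
  Qh := h.Ph
  QQ := h.PP
  PL := by rw [← h.Qh, ← Matrix.conjTranspose_mul, h.LQ]
  LQ := by rw [← h.Ph, ← Matrix.conjTranspose_mul, h.PL]
  LG := by rw [← Matrix.conjTranspose_mul, h.GLe, h.Qh]
  GLe := by rw [← Matrix.conjTranspose_mul, h.LG, h.Ph]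
  Gn := by rw [nct]; exact h.Gn
  fP := h.fQ
  fQ := h.fP

lemma PD.Pn {r : ℕ} {L : Matrix m n ℂ} {P Q G S} (h : PD r L P Q G S) : ‖P‖ ≤ 1 :=
  herm_idem_norm (by rw [h.Ph, h.PP])

lemma PD.Pn' {r : ℕ} {L : Matrix m n ℂ} {P Q G S} (h : PD r L P Q G S) : ‖1 - P‖ ≤ 1 := by
  apply herm_idem_norm
  rw [Matrix.conjTranspose_sub, h.Ph, Matrix.conjTranspose_one]
  rw [Matrix.sub_mul, Matrix.mul_sub, Matrix.mul_sub, h.PP]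
  simp

lemma PD.Qn {r : ℕ} {L : Matrix m n ℂ} {P Q G S} (h : PD r L P Q G S) : ‖Q‖ ≤ 1 := h.ct.Pn

lemma PD.Qn' {r : ℕ} {L : Matrix m n ℂ} {P Q G S} (h : PD r L P Q G S) : ‖1 - Q‖ ≤ 1 := h.ct.Pn'

lemma PD.uniq {r : ℕ} {L : Matrix m n ℂ} {P Q G S P' Q' G' S'} (h : PD r L P Q G S)
    (h' : PD r L P' Q' G' S') : P = P' := by
  have h1 : P' * P = P := by rw [← h.LG, ← Matrix.mul_assoc, h'.PL]
  have h2 : P * P' = P' := by rw [← h'.LG, ← Matrix.mul_assoc, h.PL]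
  have h3 := congrArg Matrix.conjTranspose h1
  rw [Matrix.conjTranspose_mul, h.Ph, h'.Ph, h2] at h3
  exact h3.symm

lemma frob_proj_le {r : ℕ} (W : Matrix m (Fin r) ℂ) (hW : Wᴴ * W = 1) :
    frobNorm (W * Wᴴ) ≤ r := by
  have h1 := frob_mul_le W Wᴴ
  rw [nct] at h1
  have h2 := iso_norm hW
  have h3 := frob_iso hW
  simp only [Fintype.card_fin] at h3
  have h4 := frob_nonneg W
  have h5 : frobNorm W ≤ r := by
    rcases Nat.eq_zero_or_pos r with h0 | h0
    · have : frobNorm W ^ 2 = 0 := by rw [h3, h0]; simp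
      have : frobNorm W = 0 := by simpa using this
      rw [this]; positivity
    · have : (1 : ℝ) ≤ r := by exact_mod_cast h0
      nlinarith
  nlinarith

lemma PD.of_svd {r : ℕ} {L : Matrix m n ℂ} {U : Matrix m (Fin r) ℂ} {σ : Fin r → ℝ}
    {V : Matrix n (Fin r) ℂ} (h : IsSVD L U σ V) {S : ℝ} (hS : 0 < S) (hσ : ∀ i, S ≤ σ i) :
    PD r L (U * Uᴴ) (V * Vᴴ) (V * Matrix.diagonal (fun i => ((σ i)⁻¹ : ℂ)) * Uᴴ) S := by
  obtain ⟨hU, hV, hpos, -, hL⟩ := h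
  have d1 : Matrix.diagonal (fun i => (σ i : ℂ)) * Matrix.diagonal (fun i => ((σ i)⁻¹ : ℂ)) = 1 := by
    rw [Matrix.diagonal_mul_diagonal, ← Matrix.diagonal_one]
    congr 1; ext i
    have : (σ i : ℂ) ≠ 0 := by exact_mod_cast (hpos i).ne'
    field_simp
  have d2 : Matrix.diagonal (fun i => ((σ i)⁻¹ : ℂ)) * Matrix.diagonal (fun i => (σ i : ℂ)) = 1 := by
    rw [Matrix.diagonal_mul_diagonal, ← Matrix.diagonal_one]
    congr 1; ext i
    have : (σ i : ℂ) ≠ 0 := by exact_mod_cast (hpos i).ne'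
    field_simp
  set D := Matrix.diagonal (fun i => (σ i : ℂ)) with hD
  set D' := Matrix.diagonal (fun i => ((σ i)⁻¹ : ℂ)) with hD'
  refine ⟨proj_herm U, proj_idem hU, proj_herm V, proj_idem hV, ?_, ?_, ?_, ?_, ?_, frob_proj_le U hU, frob_proj_le V hV⟩
  · rw [hL]
    calc _ = U * (Uᴴ * U) * D * Vᴴ := by simp only [Matrix.mul_assoc]
      _ = _ := by rw [hU, Matrix.mul_one]
  · rw [hL]
    calc _ = U * D * (Vᴴ * V) * Vᴴ := by simp only [Matrix.mul_assoc]
      _ = _ := by rw [hV, Matrix.mul_one]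
  · rw [hL]
    calc _ = U * D * (Vᴴ * V) * D' * Uᴴ := by simp only [Matrix.mul_assoc]
      _ = U * (D * D') * Uᴴ := by rw [hV, Matrix.mul_one]; simp only [Matrix.mul_assoc]
      _ = _ := by rw [d1, Matrix.mul_one]
  · rw [hL]
    calc _ = V * D' * (Uᴴ * U) * D * Vᴴ := by simp only [Matrix.mul_assoc]
      _ = V * (D' * D) * Vᴴ := by rw [hU, Matrix.mul_one]; simp only [Matrix.mul_assoc]
      _ = _ := by rw [d2, Matrix.mul_one]
  · have hd : ‖D'‖ ≤ 1 / S := by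
      rw [hD', Matrix.l2_opNorm_diagonal, pi_norm_le_iff_of_nonneg (by positivity)]
      intro i
      rw [norm_inv, Complex.norm_real, Real.norm_of_nonneg (hpos i).le, one_div]
      exact inv_anti₀ hS (hσ i)
    have := nmul (nmul (iso_norm hV) hd) (B := Uᴴ) (b := 1) (by rw [nct]; exact iso_norm hU)
    simpa using this

lemma svd_norm {r : ℕ} {L : Matrix m n ℂ} {U : Matrix m (Fin r) ℂ} {σ : Fin r → ℝ}
    {V : Matrix n (Fin r) ℂ} (h : IsSVD L U σ V) (hr : 0 < r) : ‖L‖ = σ ⟨0, hr⟩ := by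
  obtain ⟨hU, hV, hpos, hmono, hL⟩ := h
  have e : Uᴴ * L * V = Matrix.diagonal (fun i => (σ i : ℂ)) := by
    rw [hL]
    calc _ = (Uᴴ * U) * Matrix.diagonal (fun i => (σ i : ℂ)) * (Vᴴ * V) := by
          simp only [Matrix.mul_assoc]
      _ = _ := by rw [hU, hV]; simp
  have hd : ‖Matrix.diagonal (fun i => (σ i : ℂ))‖ = σ ⟨0, hr⟩ := by
    rw [Matrix.l2_opNorm_diagonal]
    apply le_antisymm
    · rw [pi_norm_le_iff_of_nonneg (hpos _).le]
      intro i
      rw [Complex.norm_real, Real.norm_of_nonneg (hpos i).le]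
      exact hmono _ _ (Fin.mk_le_of_le_val (Nat.zero_le _))
    · have := norm_le_pi_norm (fun i => (σ i : ℂ)) ⟨0, hr⟩
      rwa [Complex.norm_real, Real.norm_of_nonneg (hpos _).le] at this
  have hV' : ‖Vᴴ‖ ≤ 1 := by rw [nct]; exact iso_norm hV
  have hU' : ‖Uᴴ‖ ≤ 1 := by rw [nct]; exact iso_norm hU
  apply le_antisymm
  · rw [hL]
    have := nmul (nmul (iso_norm hU) hd.le) hV'
    simpa using this
  · rw [← hd, ← e]
    have := nmul (nmul hU' (le_refl ‖L‖)) (iso_norm hV)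
    simpa using this

lemma svd_weyl {r : ℕ} {L L' : Matrix m n ℂ} {U U' : Matrix m (Fin r) ℂ} {σ σ' : Fin r → ℝ}
    {V V' : Matrix n (Fin r) ℂ} (h : IsSVD L U σ V) (h' : IsSVD L' U' σ' V') {S : ℝ} (hS : 0 < S)
    (hσ : ∀ i, S ≤ σ i) (hlt : ‖L - L'‖ < S) (i : Fin r) : S - ‖L - L'‖ ≤ σ' i := by
  have pd := PD.of_svd h hS hσ
  set G := (V * Matrix.diagonal (fun i => ((σ i)⁻¹ : ℂ)) * Uᴴ) with hG
  obtain ⟨hU, hV, hpos, hmono, hL⟩ := h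
  obtain ⟨hU', hV', hpos', hmono', hL'⟩ := h'
  have key : ∀ y : Matrix (Fin r) Unit ℂ, (S - ‖L - L'‖) * ‖y‖ ≤ ‖L' * (V * y)‖ := by
    intro y
    have e : y = Vᴴ * (G * (L * (V * y))) := by
      calc y = (Vᴴ * V) * (Vᴴ * V) * y := by rw [hV]; simp
        _ = Vᴴ * (V * Vᴴ) * (V * y) := by simp only [Matrix.mul_assoc]
        _ = _ := by rw [← pd.GLe]; simp only [Matrix.mul_assoc]
    have h1 : ‖y‖ ≤ 1 * (1 / S * ‖L * (V * y)‖) := by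
      conv_lhs => rw [e]
      exact nmul (by rw [nct]; exact iso_norm hV) (nmul pd.Gn le_rfl)
    have h2 : S * ‖y‖ ≤ ‖L * (V * y)‖ := by
      calc S * ‖y‖ ≤ S * (1 * (1 / S * ‖L * (V * y)‖)) := by gcongr
        _ = _ := by field_simp
    have h3 : L * (V * y) = L' * (V * y) + (L - L') * (V * y) := by rw [Matrix.sub_mul]; abel
    have h4 : ‖(L - L') * (V * y)‖ ≤ ‖L - L'‖ * (1 * ‖y‖) :=
      nmul le_rfl (nmul (iso_norm hV) le_rfl)
    have h5 := norm_add_le (L' * (V * y)) ((L - L') * (V * y))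
    rw [← h3] at h5
    linarith
  set W := V'ᴴ * V with hW
  have eqL' : ∀ y : Matrix (Fin r) Unit ℂ,
      L' * (V * y) = U' * (Matrix.diagonal (fun i => (σ' i : ℂ)) * (W * y)) := by
    intro y; rw [hL', hW]; simp only [Matrix.mul_assoc]
  have hdet : W.det ≠ 0 := by
    intro h0
    obtain ⟨v, hv, hv0⟩ := Matrix.exists_mulVec_eq_zero_iff.mpr h0
    apply hv
    have h1 : W * Matrix.replicateCol Unit v = 0 := by
      rw [← Matrix.replicateCol_mulVec, hv0]; ext; simp
    have h2 := key (Matrix.replicateCol Unit v)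
    rw [eqL', h1] at h2
    simp only [Matrix.mul_zero, norm_zero] at h2
    have h3 : ‖Matrix.replicateCol Unit v‖ ≤ 0 := by
      by_contra hc
      push Not at hc
      have := mul_pos (sub_pos.mpr hlt) hc
      linarith
    have h4 := norm_le_zero_iff.mp h3
    ext j
    have := congrFun (congrFun h4 j) ()
    simpa using this
  have hk := key (W⁻¹ * (er i)ᴴ)
  have hWy : W * (W⁻¹ * (er i)ᴴ) = (er i)ᴴ := by
    rw [← Matrix.mul_assoc, Matrix.mul_nonsing_inv _ (isUnit_iff_ne_zero.mpr hdet), Matrix.one_mul]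
  have hn1 : 1 ≤ ‖(er i : Matrix Unit (Fin r) ℂ)‖ := by
    rw [row_norm_eq]
    have : ∀ j, ‖(er i : Matrix Unit (Fin r) ℂ) () j‖ ^ 2 = if j = i then 1 else 0 := by
      intro j; simp only [er, Matrix.of_apply]; split_ifs <;> simp
    simp [this]
  have hy1 : 1 ≤ ‖W⁻¹ * (er i)ᴴ‖ := by
    have h1 : ‖W * (W⁻¹ * (er i)ᴴ)‖ ≤ (1 * 1) * ‖W⁻¹ * (er i)ᴴ‖ :=
      nmul (nmul (by rw [nct]; exact iso_norm hV') (iso_norm hV)) le_rfl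
    rw [hWy, nct] at h1
    linarith
  have hsm : Matrix.diagonal (fun i => (σ' i : ℂ)) * (er i)ᴴ = (σ' i : ℂ) • (er i)ᴴ := by
    ext a u
    simp only [Matrix.diagonal_mul, Matrix.smul_apply, Matrix.conjTranspose_apply, er,
      Matrix.of_apply, smul_eq_mul]
    split_ifs with hh
    · rw [hh]
    · simp
  rw [eqL', hWy, hsm] at hk
  have h6 : ‖U' * ((σ' i : ℂ) • (er i)ᴴ)‖ ≤ 1 * σ' i := by
    refine nmul (iso_norm hU') ?_
    rw [norm_smul, Complex.norm_real, Real.norm_of_nonneg (hpos' i).le, nct]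
    have := mul_le_mul_of_nonneg_left (er_norm i) (hpos' i).le
    linarith
  have := mul_le_mul_of_nonneg_left hy1 (sub_pos.mpr hlt).le
  linarith

lemma best_left {r : ℕ} {M L : Matrix m n ℂ} {P Q G S} (h : PD r L P Q G S)
    (hb : IsBestRankApprox r M L) : P * M = L := by
  obtain ⟨hrk, hb⟩ := hb
  have hP : (P * M).rank ≤ r := by
    rw [← h.LG, Matrix.mul_assoc]
    exact (Matrix.rank_mul_le_left _ _).trans hrk
  have h1 := hb _ hP
  have h2 : M - L = (P * M - L) + (M - P * M) := by abel
  have h3 : (P * M - L)ᴴ * (M - P * M) = 0 := by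
    have e1 : P * M - L = P * (M - L) := by rw [Matrix.mul_sub, h.PL]
    rw [e1, Matrix.conjTranspose_mul, h.Ph]
    calc _ = (M - L)ᴴ * (P * M - (P * P) * M) := by
            simp only [Matrix.mul_sub, Matrix.mul_assoc]
      _ = 0 := by rw [h.PP]; simp
  have h4 := frob_pyth _ _ h3
  rw [← h2] at h4
  have h5 := pow_le_pow_left₀ (frob_nonneg _) h1 2
  have h6 : frobNorm (P * M - L) ^ 2 = 0 := le_antisymm (by linarith) (sq_nonneg _)
  exact sub_eq_zero.mp (frob_eq_zero h6)

open scoped ComplexOrder in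
lemma best_ct {r : ℕ} {M L : Matrix m n ℂ} (hb : IsBestRankApprox r M L) :
    IsBestRankApprox r Mᴴ Lᴴ := by
  obtain ⟨hrk, hb⟩ := hb
  refine ⟨by rwa [Matrix.rank_conjTranspose], fun B hB => ?_⟩
  have := hb Bᴴ (by rwa [Matrix.rank_conjTranspose])
  rw [← Matrix.conjTranspose_sub, frob_ct, ← frob_ct (Mᴴ - B), Matrix.conjTranspose_sub,
    Matrix.conjTranspose_conjTranspose]
  exact this

lemma best_right {r : ℕ} {M L : Matrix m n ℂ} {P Q G S} (h : PD r L P Q G S)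
    (hb : IsBestRankApprox r M L) : M * Q = L := by
  have := congrArg Matrix.conjTranspose (best_left h.ct (best_ct hb))
  simpa [Matrix.conjTranspose_mul, h.Qh] using this

end core

section core2

set_option linter.unusedSectionVars false
set_option linter.unusedVariables false
set_option linter.unusedSimpArgs false

variable {m n : Type*} [Fintype m] [Fintype n] [DecidableEq m] [DecidableEq n]

/-- The hypotheses common to all estimates of one step. -/
structure Step (r : ℕ) (L Lk L' E M : Matrix m n ℂ) (P Pk P' : Matrix m m ℂ) (Q Qk Q' : Matrix n n ℂ)
    (G Gk G' : Matrix n m ℂ) (S Sk S' κ τ w : ℝ) : Prop where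
  pd : PD r L P Q G S
  pdk : PD r Lk Pk Qk Gk Sk
  pd' : PD r L' P' Q' G' S'
  hM : M = Pk * (L + E) + (L + E) * Qk - Pk * (L + E) * Qk
  PM : P' * M = L'
  MQ : M * Q' = L'
  fb : frobNorm (M - L') ≤ frobNorm (M - L)
  hS : 0 < S
  hw : 0 ≤ w
  hwS : w ≤ S
  hκ : 1 ≤ κ
  hτ : 0 ≤ τ
  hκτ : κ * τ ≤ 1 / 1000
  hrτ : r * τ ≤ 1 / 1000
  hD : ‖L - Lk‖ ≤ 2 * τ * w
  hE : ‖E‖ ≤ τ * w / (4 * κ)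

variable {r : ℕ} {L Lk L' E M : Matrix m n ℂ} {P Pk P' : Matrix m m ℂ} {Q Qk Q' : Matrix n n ℂ}
    {G Gk G' : Matrix n m ℂ} {S Sk S' κ τ w : ℝ}

lemma Step.ct (h : Step r L Lk L' E M P Pk P' Q Qk Q' G Gk G' S Sk S' κ τ w) :
    Step r Lᴴ Lkᴴ L'ᴴ Eᴴ Mᴴ Q Qk Q' P Pk P' Gᴴ Gkᴴ G'ᴴ S Sk S' κ τ w where
  pd := h.pd.ct
  pdk := h.pdk.ct
  pd' := h.pd'.ct
  hM := by
    rw [h.hM]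
    simp only [Matrix.conjTranspose_sub, Matrix.conjTranspose_add, Matrix.conjTranspose_mul,
      h.pdk.Ph, h.pdk.Qh, Matrix.mul_assoc]
    abel
  PM := by rw [← h.pd'.Qh, ← Matrix.conjTranspose_mul, h.MQ]
  MQ := by rw [← h.pd'.Ph, ← Matrix.conjTranspose_mul, h.PM]
  fb := by rw [← Matrix.conjTranspose_sub, ← Matrix.conjTranspose_sub, frob_ct, frob_ct]; exact h.fb
  hS := h.hS
  hw := h.hw
  hwS := h.hwS
  hκ := h.hκ
  hτ := h.hτ
  hκτ := h.hκτ
  hrτ := h.hrτ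
  hD := by rw [← Matrix.conjTranspose_sub, nct]; exact h.hD
  hE := by rw [nct]; exact h.hE

lemma Step.Zeq (h : Step r L Lk L' E M P Pk P' Q Qk Q' G Gk G' S Sk S' κ τ w) :
    M - L = (Pk * E + (1 - Pk) * E * Qk) - (1 - Pk) * P * ((L - Lk) * (1 - Qk)) := by
  have e1 : (1 - Pk) * P * ((L - Lk) * (1 - Qk)) = (1 - Pk) * (L * (1 - Qk)) := by
    have a1 : (L - Lk) * (1 - Qk) = L * (1 - Qk) := by
      rw [Matrix.sub_mul, Matrix.mul_sub Lk, h.pdk.LQ]; simp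
    rw [a1, Matrix.mul_assoc, ← Matrix.mul_assoc P, h.pd.PL]
  rw [e1, h.hM]
  simp only [Matrix.mul_add, Matrix.add_mul, Matrix.mul_sub, Matrix.sub_mul, Matrix.mul_one,
    Matrix.one_mul, Matrix.mul_assoc]
  abel

lemma Step.PkP (h : Step r L Lk L' E M P Pk P' Q Qk Q' G Gk G' S Sk S' κ τ w) :
    ‖(1 - Pk) * P‖ ≤ 2 * τ := by
  have e : (1 - Pk) * P = (1 - Pk) * (L - Lk) * G := by
    have a1 : (1 - Pk) * (L - Lk) = (1 - Pk) * L := by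
      rw [Matrix.mul_sub, Matrix.sub_mul 1 Pk Lk, h.pdk.PL]; simp
    rw [a1, Matrix.mul_assoc, h.pd.LG]
  rw [e]
  have h1 : ‖(1 - Pk) * (L - Lk) * G‖ ≤ 1 * (2 * τ * w) * (1 / S) :=
    nmul (nmul h.pdk.Pn' h.hD) h.pd.Gn
  have hS := h.hS
  calc _ ≤ _ := h1
    _ ≤ 1 * (2 * τ * S) * (1 / S) := by
      have := h.hwS; have := h.hτ; gcongr
    _ = _ := by field_simp

lemma Step.E1 (h : Step r L Lk L' E M P Pk P' Q Qk Q' G Gk G' S Sk S' κ τ w) :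
    ‖E‖ ≤ τ * w / 4 := by
  refine h.hE.trans ?_
  have := h.hκ; have := h.hτ; have := h.hw
  apply div_le_div_of_nonneg_left <;> nlinarith [mul_nonneg h.hτ h.hw]

lemma Step.κE (h : Step r L Lk L' E M P Pk P' Q Qk Q' G Gk G' S Sk S' κ τ w) :
    κ * ‖E‖ ≤ τ * w / 4 := by
  have hκ : 0 < κ := by linarith [h.hκ]
  calc κ * ‖E‖ ≤ κ * (τ * w / (4 * κ)) := by gcongr; exact h.hE
    _ = _ := by field_simp

lemma Step.τ1 (h : Step r L Lk L' E M P Pk P' Q Qk Q' G Gk G' S Sk S' κ τ w) :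
    τ ≤ 1 / 1000 := by nlinarith [h.hκτ, h.hκ, h.hτ]

lemma sqrt2_lt : Real.sqrt 2 < 1.4143 := by
  rw [Real.sqrt_lt' (by norm_num)]; norm_num

/-- `κ‖Z‖ ≤ 0.36 τ w`. -/
lemma Step.κZ (h : Step r L Lk L' E M P Pk P' Q Qk Q' G Gk G' S Sk S' κ τ w) :
    κ * ‖M - L‖ ≤ 0.36 * (τ * w) := by
  have hκ : 0 < κ := by linarith [h.hκ]
  have h1 : ‖Pk * E + (1 - Pk) * E * Qk‖ ≤ Real.sqrt 2 * ‖E‖ :=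
    tangent_norm h.pdk.Ph h.pdk.PP h.pdk.Qh h.pdk.Qn h.pdk.Pn h.pdk.Pn' E
  have h2 : ‖(1 - Pk) * P * ((L - Lk) * (1 - Qk))‖ ≤ 2 * τ * ((2 * τ * w) * 1) :=
    nmul h.PkP (nmul h.hD h.pdk.Qn')
  have h3 := norm_sub_le (Pk * E + (1 - Pk) * E * Qk) ((1 - Pk) * P * ((L - Lk) * (1 - Qk)))
  rw [← h.Zeq] at h3
  have h4 : ‖M - L‖ ≤ 1.4143 * ‖E‖ + 4 * τ * (τ * w) := by
    have := mul_le_mul_of_nonneg_right sqrt2_lt.le (norm_nonneg E)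
    linarith
  have h5 := mul_le_mul_of_nonneg_left h4 hκ.le
  have h6 := h.κE
  have h7 := mul_le_mul_of_nonneg_right h.hκτ (mul_nonneg h.hτ h.hw)
  have h8 := mul_nonneg h.hτ h.hw
  nlinarith

lemma Step.Z1 (h : Step r L Lk L' E M P Pk P' Q Qk Q' G Gk G' S Sk S' κ τ w) :
    ‖M - L‖ ≤ 0.36 * (τ * w) := by
  have := h.κZ
  nlinarith [norm_nonneg (M - L), h.hκ]

lemma Step.Zf (h : Step r L Lk L' E M P Pk P' Q Qk Q' G Gk G' S Sk S' κ τ w) :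
    frobNorm (M - L) ≤ 0.0025 * w := by
  have hr : (0 : ℝ) ≤ r := by positivity
  have hw := mul_nonneg h.hτ h.hw
  have f1 : frobNorm (Pk * E) ≤ r * (τ * w / 4) :=
    (frob_mul_le _ _).trans (mul_le_mul h.pdk.fP h.E1 (norm_nonneg _) hr)
  have f2 : frobNorm ((1 - Pk) * E * Qk) ≤ (1 * (τ * w / 4)) * r :=
    (frob_mul_le' _ _).trans (mul_le_mul (nmul h.pdk.Pn' h.E1) h.pdk.fQ (frob_nonneg _) (by linarith))
  have f3 : frobNorm ((1 - Pk) * P * ((L - Lk) * (1 - Qk))) ≤ (1 * r) * ((2 * τ * w) * 1) := by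
    refine (frob_mul_le _ _).trans (mul_le_mul ?_ (nmul h.hD h.pdk.Qn') (norm_nonneg _) (by linarith))
    exact (frob_mul_le' _ _).trans (mul_le_mul h.pdk.Pn' h.pd.fP (frob_nonneg _) (by norm_num))
  have f4 := frob_add_le (Pk * E) ((1 - Pk) * E * Qk)
  have f5 := frob_add_le (Pk * E + (1 - Pk) * E * Qk) (-((1 - Pk) * P * ((L - Lk) * (1 - Qk))))
  rw [frob_neg, ← sub_eq_add_neg, ← h.Zeq] at f5
  have := mul_le_mul_of_nonneg_right h.hrτ h.hw
  nlinarith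

/-- The residual, as a right projection. -/
lemma Step.LQ' (h : Step r L Lk L' E M P Pk P' Q Qk Q' G Gk G' S Sk S' κ τ w) :
    L * (1 - Q') = (M - L') - (M - L) * (1 - Q') := by
  simp only [Matrix.mul_sub, Matrix.sub_mul, Matrix.mul_one, h.MQ]; abel

lemma Step.P'L (h : Step r L Lk L' E M P Pk P' Q Qk Q' G Gk G' S Sk S' κ τ w) :
    (1 - P') * L = (M - L') - (1 - P') * (M - L) := by
  simp only [Matrix.mul_sub, Matrix.sub_mul, Matrix.one_mul, h.PM]; abel

lemma Step.R1 (h : Step r L Lk L' E M P Pk P' Q Qk Q' G Gk G' S Sk S' κ τ w) :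
    M - L' = (1 - P') * L * (1 - Q') + (1 - P') * (M - L) * (1 - Q') := by
  have : P' * L' = L' := h.pd'.PL
  simp only [Matrix.mul_sub, Matrix.sub_mul, Matrix.one_mul, Matrix.mul_one, h.PM, h.pd'.LQ, h.MQ]
  abel

lemma Step.eps (h : Step r L Lk L' E M P Pk P' Q Qk Q' G Gk G' S Sk S' κ τ w) :
    ‖(1 - P') * P‖ ≤ 0.003 := by
  have hS := h.hS
  have h1 : ‖M - L'‖ ≤ 0.0025 * w := (norm_le_frob _).trans (h.fb.trans h.Zf)
  have h2 : ‖(1 - P') * (M - L)‖ ≤ 1 * (0.36 * (τ * w)) := nmul h.pd'.Pn' h.Z1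
  have h3 := norm_sub_le (M - L') ((1 - P') * (M - L))
  rw [← h.P'L] at h3
  have h4 := mul_le_mul_of_nonneg_right h.τ1 h.hw
  have h5 : ‖(1 - P') * L‖ ≤ 0.003 * S := by linarith [h.hwS, h.hw]
  have h6 : ‖(1 - P') * L * G‖ ≤ 0.003 * S * (1 / S) := nmul h5 h.pd.Gn
  rw [Matrix.mul_assoc, h.pd.LG] at h6
  calc _ ≤ _ := h6
    _ = _ := by field_simp

lemma Step.PLQ (h : Step r L Lk L' E M P Pk P' Q Qk Q' G Gk G' S Sk S' κ τ w) :
    ‖(1 - P') * L * (1 - Q')‖ ≤ 0.003 * ‖L * (1 - Q')‖ := by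
  have e : (1 - P') * L * (1 - Q') = (1 - P') * P * (L * (1 - Q')) := by
    rw [Matrix.mul_assoc, Matrix.mul_assoc, ← Matrix.mul_assoc P, h.pd.PL]
  rw [e]
  exact nmul h.eps le_rfl

lemma Step.d (h : Step r L Lk L' E M P Pk P' Q Qk Q' G Gk G' S Sk S' κ τ w) :
    ‖L * (1 - Q')‖ ≤ 2 * ‖M - L‖ := by
  have e : L * (1 - Q') = (1 - P') * L * (1 - Q') - P' * (M - L) * (1 - Q') := by
    rw [h.LQ']
    conv_lhs => rw [h.R1]
    simp only [Matrix.sub_mul 1 P', Matrix.one_mul, Matrix.sub_mul _ _ (1 - Q')]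
    abel
  have h1 : ‖P' * (M - L) * (1 - Q')‖ ≤ 1 * ‖M - L‖ * 1 := nmul (nmul h.pd'.Pn le_rfl) h.pd'.Qn'
  have h2 := norm_sub_le ((1 - P') * L * (1 - Q')) (P' * (M - L) * (1 - Q'))
  rw [← e] at h2
  have := h.PLQ
  have := norm_nonneg (L * (1 - Q'))
  linarith

/-- The spectral norm estimate. -/
lemma Step.spec (h : Step r L Lk L' E M P Pk P' Q Qk Q' G Gk G' S Sk S' κ τ w) :
    ‖L - L'‖ ≤ 0.52 * (τ * w) := by
  have e : L - L' = (1 - P') * L * (1 - Q') - (P' * (M - L) + (1 - P') * (M - L) * Q') := by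
    calc L - L' = (M - L') - (M - L) := by abel
      _ = _ := by
        rw [h.R1]
        simp only [Matrix.sub_mul, Matrix.mul_sub, Matrix.one_mul, Matrix.mul_one]
        abel
  have h1 := tangent_norm h.pd'.Ph h.pd'.PP h.pd'.Qh h.pd'.Qn h.pd'.Pn h.pd'.Pn' (M - L)
  have h2 := norm_sub_le ((1 - P') * L * (1 - Q')) (P' * (M - L) + (1 - P') * (M - L) * Q')
  rw [← e] at h2
  have h3 := h.PLQ
  have h4 := h.d
  have h5 := h.Z1
  have h6 := mul_le_mul_of_nonneg_right sqrt2_lt.le (norm_nonneg (M - L))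
  have h7 := mul_nonneg h.hτ h.hw
  linarith

/-- Row estimate of the perturbation. -/
lemma Step.rowZ (h : Step r L Lk L' E M P Pk P' Q Qk Q' G Gk G' S Sk S' κ τ w) {b : ℝ} (hb : 0 ≤ b)
    (f : Matrix Unit m ℂ) (hf : ‖f * P‖ ≤ b) (hfk : ‖f * Pk‖ ≤ 2 * κ * b)
    (hfE : ‖f * E * Qk‖ ≤ b * (τ * w)) : ‖f * (M - L)‖ ≤ 9 * (κ * τ) * (b * w) := by
  have hκ0 : 0 ≤ κ := by linarith [h.hκ]
  have hτ := h.hτ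
  have hw := h.hw
  have e : f * (M - L) = f * Pk * E + f * E * Qk - f * Pk * (E * Qk)
      - (f * P - f * Pk * P) * ((L - Lk) * (1 - Qk)) := by
    rw [h.Zeq]
    simp only [Matrix.sub_mul, Matrix.mul_sub, Matrix.mul_add, Matrix.add_mul, Matrix.one_mul, Matrix.mul_one,
      Matrix.mul_assoc]
    abel
  have a1 : ‖f * Pk * E‖ ≤ 2 * κ * b * (τ * w / 4) := nmul hfk h.E1
  have a2 : ‖f * Pk * (E * Qk)‖ ≤ 2 * κ * b * ((τ * w / 4) * 1) := nmul hfk (nmul h.E1 h.pdk.Qn)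
  have a3 : ‖f * P - f * Pk * P‖ ≤ b + 2 * κ * b * 1 :=
    (norm_sub_le _ _).trans (add_le_add hf (nmul hfk h.pd.Pn))
  have a4 : ‖(f * P - f * Pk * P) * ((L - Lk) * (1 - Qk))‖ ≤ (b + 2 * κ * b * 1) * ((2 * τ * w) * 1) :=
    nmul a3 (nmul h.hD h.pdk.Qn')
  have t1 := norm_sub_le (f * Pk * E + f * E * Qk - f * Pk * (E * Qk))
    ((f * P - f * Pk * P) * ((L - Lk) * (1 - Qk)))
  have t2 := norm_sub_le (f * Pk * E + f * E * Qk) (f * Pk * (E * Qk))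
  have t3 := norm_add_le (f * Pk * E) (f * E * Qk)
  rw [← e] at t1
  have p1 : 0 ≤ b * τ * w := by positivity
  have p2 : b * τ * w ≤ κ * (b * τ * w) := by nlinarith [h.hκ]
  nlinarith

/-- Row estimate for the new projection. -/
lemma Step.rowP' (h : Step r L Lk L' E M P Pk P' Q Qk Q' G Gk G' S Sk S' κ τ w) {b : ℝ} (hb : 0 ≤ b)
    (f : Matrix Unit m ℂ) (hf : ‖f * P‖ ≤ b) (hfk : ‖f * Pk‖ ≤ 2 * κ * b)
    (hfE : ‖f * E * Qk‖ ≤ b * (τ * w)) (hL : ‖L‖ ≤ κ * S) (hS' : 0.99 * S ≤ S') :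
    ‖f * P'‖ ≤ 2 * κ * b := by
  have hκ := h.hκ
  have hS := h.hS
  have e : f * P' = (f * P * L + f * (M - L)) * (Q' * G') := by
    have a1 : f * P * L + f * (M - L) = f * M := by
      rw [Matrix.mul_assoc, h.pd.PL, Matrix.mul_sub]; abel
    rw [a1, ← Matrix.mul_assoc, Matrix.mul_assoc f, h.MQ, Matrix.mul_assoc, h.pd'.LG]
  have r1 := h.rowZ hb f hf hfk hfE
  have r2 : ‖f * P * L‖ ≤ b * (κ * S) := nmul hf hL
  have r3 : ‖f * P * L + f * (M - L)‖ ≤ 1.9 * κ * b * S := by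
    refine (norm_add_le _ _).trans ?_
    have p1 : κ * τ * (b * w) ≤ 1 / 1000 * (b * S) :=
      mul_le_mul h.hκτ (mul_le_mul_of_nonneg_left h.hwS hb) (mul_nonneg hb h.hw) (by norm_num)
    have p2 : b * S ≤ κ * (b * S) := by nlinarith [mul_nonneg hb hS.le]
    nlinarith
  have r4 : ‖Q' * G'‖ ≤ 1 * (1 / (0.99 * S)) := by
    refine nmul h.pd'.Qn (h.pd'.Gn.trans ?_)
    exact one_div_le_one_div_of_le (by positivity) hS'
  rw [e]
  calc _ ≤ 1.9 * κ * b * S * (1 * (1 / (0.99 * S))) := nmul r3 r4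
    _ = (1.9 / 0.99) * (κ * b) := by field_simp
    _ ≤ 2 * (κ * b) := by
      apply mul_le_mul_of_nonneg_right (by norm_num)
      exact mul_nonneg (by linarith) hb
    _ = _ := by ring

lemma Step.rowPL (h : Step r L Lk L' E M P Pk P' Q Qk Q' G Gk G' S Sk S' κ τ w) {b : ℝ} (hb : 0 ≤ b)
    (f : Matrix Unit m ℂ) (hf : ‖f * P‖ ≤ b) (hfk : ‖f * Pk‖ ≤ 2 * κ * b)
    (hfE : ‖f * E * Qk‖ ≤ b * (τ * w)) (hf' : ‖f * P'‖ ≤ 2 * κ * b) :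
    ‖f * ((1 - P') * L)‖ ≤ 20 * (κ * τ) * (b * w) := by
  have hκ := h.hκ
  have hS := h.hS
  have e : f * ((1 - P') * L) = f * P * (L * (1 - Q')) + f * (M - L) * (1 - Q')
      - f * (M - L) + f * P' * (M - L) := by
    have a0 : f * P * (L * (1 - Q')) = f * (L * (1 - Q')) := by
      rw [Matrix.mul_assoc, ← Matrix.mul_assoc P, h.pd.PL]
    rw [a0, h.P'L, h.LQ']
    simp only [Matrix.sub_mul, Matrix.mul_sub, Matrix.one_mul, Matrix.mul_one, Matrix.mul_assoc]
    abel
  have r1 := h.rowZ hb f hf hfk hfE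
  have a1 : ‖f * P * (L * (1 - Q'))‖ ≤ b * (2 * ‖M - L‖) := nmul hf h.d
  have a2 : ‖f * (M - L) * (1 - Q')‖ ≤ 9 * (κ * τ) * (b * w) * 1 := nmul r1 h.pd'.Qn'
  have a3 : ‖f * P' * (M - L)‖ ≤ 2 * κ * b * ‖M - L‖ := nmul hf' le_rfl
  have t1 := norm_add_le (f * P * (L * (1 - Q')) + f * (M - L) * (1 - Q') - f * (M - L)) (f * P' * (M - L))
  have t2 := norm_sub_le (f * P * (L * (1 - Q')) + f * (M - L) * (1 - Q')) (f * (M - L))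
  have t3 := norm_add_le (f * P * (L * (1 - Q'))) (f * (M - L) * (1 - Q'))
  rw [← e] at t1
  have z1 := mul_le_mul_of_nonneg_left h.Z1 hb
  have z2 := mul_le_mul_of_nonneg_left h.κZ hb
  have p1 : 0 ≤ b * (τ * w) := mul_nonneg hb (mul_nonneg h.hτ h.hw)
  have p2 : b * (τ * w) ≤ κ * (b * (τ * w)) := by nlinarith
  nlinarith

/-- Entrywise estimate. -/
lemma Step.entry (h : Step r L Lk L' E M P Pk P' Q Qk Q' G Gk G' S Sk S' κ τ w) {b : ℝ} (hb : 0 ≤ b)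
    (f : Matrix Unit m ℂ) (g : Matrix n Unit ℂ) (hf : ‖f * P‖ ≤ b) (hg : ‖Q * g‖ ≤ b)
    (hf' : ‖f * P'‖ ≤ 2 * κ * b) (hg' : ‖Q' * g‖ ≤ 2 * κ * b)
    (hfL : ‖f * ((1 - P') * L)‖ ≤ 20 * (κ * τ) * (b * w))
    (hgL : ‖L * (1 - Q') * g‖ ≤ 20 * (κ * τ) * (b * w)) :
    ‖f * (L - L') * g‖ ≤ 0.05 * (b ^ 2 * w) := by
  have hκ := h.hκ
  have hS := h.hS
  have hw := h.hw
  have hτ := h.hτ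
  have hκ0 : 0 ≤ κ := by linarith
  have e : f * (L - L') * g = f * ((1 - P') * L) * (Q * g) + f * P * (L * (1 - Q') * g)
      - f * ((1 - P') * L) * (G * (L * (1 - Q') * g)) - f * P' * (M - L) * (Q' * g) := by
    have a1 : f * ((1 - P') * L) * (Q * g) = f * ((1 - P') * L) * g := by
      conv_rhs => rw [← h.pd.LQ]
      simp only [Matrix.mul_assoc]
    have a2 : f * P * (L * (1 - Q') * g) = f * (L * (1 - Q') * g) := by
      conv_rhs => rw [← h.pd.PL]
      simp only [Matrix.mul_assoc]
    have a3 : f * ((1 - P') * L) * (G * (L * (1 - Q') * g)) = f * ((1 - P') * (L * ((1 - Q') * g))) := by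
      calc _ = f * ((1 - P') * ((L * G * L) * ((1 - Q') * g))) := by simp only [Matrix.mul_assoc]
        _ = _ := by rw [h.pd.LG, h.pd.PL]
    have a4 : f * P' * (M - L) * (Q' * g) = f * L' * g - f * P' * L * (Q' * g) := by
      have : f * L' * g = f * (P' * M * Q') * g := by rw [h.PM, h.pd'.LQ]
      rw [this]
      simp only [Matrix.sub_mul, Matrix.mul_sub, Matrix.mul_assoc]
    rw [a1, a2, a3, a4]
    simp only [Matrix.sub_mul, Matrix.mul_sub, Matrix.one_mul, Matrix.mul_one, Matrix.mul_assoc]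
    abel
  set η := κ * τ with hη
  have hη0 : 0 ≤ η := mul_nonneg hκ0 hτ
  have hη1 : η ≤ 1 / 1000 := h.hκτ
  have n1 : ‖f * ((1 - P') * L) * (Q * g)‖ ≤ 20 * η * (b * w) * b := nmul hfL hg
  have n2 : ‖f * P * (L * (1 - Q') * g)‖ ≤ b * (20 * η * (b * w)) := nmul hf hgL
  have n3 : ‖f * ((1 - P') * L) * (G * (L * (1 - Q') * g))‖
      ≤ 20 * η * (b * w) * (1 / S * (20 * η * (b * w))) := nmul hfL (nmul h.pd.Gn hgL)
  have n4 : ‖f * P' * (M - L) * (Q' * g)‖ ≤ 2 * κ * b * ‖M - L‖ * (2 * κ * b) :=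
    nmul (nmul hf' le_rfl) hg'
  have n3' : 20 * η * (b * w) * (1 / S * (20 * η * (b * w))) ≤ η * (b ^ 2 * w) := by
    have : 20 * η * (b * w) * (1 / S * (20 * η * (b * w))) = (400 * η) * (w / S) * (η * (b ^ 2 * w)) := by
      field_simp; ring
    rw [this]
    have q1 : w / S ≤ 1 := (div_le_one hS).mpr h.hwS
    have q2 : (400 * η) * (w / S) ≤ 1 * 1 :=
      mul_le_mul (by linarith) q1 (by positivity) (by norm_num)
    have q3 : 0 ≤ η * (b ^ 2 * w) := by positivity
    nlinarith
  have n4' : 2 * κ * b * ‖M - L‖ * (2 * κ * b) ≤ 1.44 * (η * (b ^ 2 * w)) := by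
    have := mul_le_mul_of_nonneg_left h.κZ (show 0 ≤ 4 * κ * b ^ 2 by positivity)
    rw [hη]; nlinarith
  have t1 := norm_sub_le (f * ((1 - P') * L) * (Q * g) + f * P * (L * (1 - Q') * g)
      - f * ((1 - P') * L) * (G * (L * (1 - Q') * g))) (f * P' * (M - L) * (Q' * g))
  have t2 := norm_sub_le (f * ((1 - P') * L) * (Q * g) + f * P * (L * (1 - Q') * g))
      (f * ((1 - P') * L) * (G * (L * (1 - Q') * g)))
  have t3 := norm_add_le (f * ((1 - P') * L) * (Q * g)) (f * P * (L * (1 - Q') * g))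
  rw [← e] at t1
  have q4 : η * (b ^ 2 * w) ≤ 1 / 1000 * (b ^ 2 * w) :=
    mul_le_mul_of_nonneg_right hη1 (by positivity)
  nlinarith

end core2

section hankelsec

set_option linter.unusedSectionVars false

lemma schur {m n : Type*} [Fintype m] [Fintype n] [DecidableEq m] [DecidableEq n]
    (A : Matrix m n ℂ) {C : ℝ} (hC : 0 ≤ C) (h1 : ∀ i, ∑ j, ‖A i j‖ ≤ C)
    (h2 : ∀ j, ∑ i, ‖A i j‖ ≤ C) : ‖A‖ ≤ C := by
  apply opnorm_le _ hC
  intro x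
  have hi : ∀ i, ‖(A *ᵥ x) i‖ ^ 2 ≤ C * ∑ j, ‖A i j‖ * ‖x j‖ ^ 2 := by
    intro i
    have e1 : ‖(A *ᵥ x) i‖ ≤ ∑ j, ‖A i j‖ * ‖x j‖ := by
      simp only [Matrix.mulVec, dotProduct]
      exact (norm_sum_le _ _).trans (by simp)
    have e2 : (∑ j, ‖A i j‖ * ‖x j‖) ^ 2 ≤ (∑ j, ‖A i j‖) * ∑ j, ‖A i j‖ * ‖x j‖ ^ 2 :=
      Finset.sum_sq_le_sum_mul_sum_of_sq_le_mul _ (fun _ _ => norm_nonneg _)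
        (fun _ _ => by positivity) (fun _ _ => le_of_eq (by ring))
    refine (pow_le_pow_left₀ (norm_nonneg _) e1 2).trans (e2.trans ?_)
    exact mul_le_mul_of_nonneg_right (h1 i) (Finset.sum_nonneg fun _ _ => by positivity)
  calc _ ≤ ∑ i, C * ∑ j, ‖A i j‖ * ‖x j‖ ^ 2 := Finset.sum_le_sum fun i _ => hi i
    _ = C * ∑ j, (∑ i, ‖A i j‖) * ‖x j‖ ^ 2 := by
      rw [← Finset.mul_sum, Finset.sum_comm]; simp only [Finset.sum_mul]
    _ ≤ C * ∑ j, C * ‖x j‖ ^ 2 := by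
      apply mul_le_mul_of_nonneg_left _ hC
      exact Finset.sum_le_sum fun j _ => mul_le_mul_of_nonneg_right (h2 j) (sq_nonneg _)
    _ = _ := by rw [← Finset.mul_sum]; ring

lemma row_comb {m n l : Type*} [Fintype m] [Fintype n] [DecidableEq m] [DecidableEq n]
    [Fintype l] [DecidableEq l]
    (A : Matrix m n ℂ) (B : Matrix n l ℂ) {C d : ℝ} (hd : 0 ≤ d) (i : m) (h1 : ∑ j, ‖A i j‖ ≤ C)
    (h2 : ∀ j : n, ‖er j * B‖ ≤ d) : ‖er i * A * B‖ ≤ C * d := by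
  have e : er i * A * B = ∑ j, A i j • (er j * B) := by
    ext u a
    rw [Matrix.mul_assoc, er_mul, Matrix.sum_apply, Matrix.mul_apply]
    refine Finset.sum_congr rfl fun j _ => ?_
    rw [Matrix.smul_apply, er_mul, smul_eq_mul]
  rw [e]
  refine (norm_sum_le _ _).trans ?_
  calc _ ≤ ∑ j, ‖A i j‖ * d := Finset.sum_le_sum fun j _ => by
        rw [norm_smul]; exact mul_le_mul_of_nonneg_left (h2 j) (norm_nonneg _)
    _ = (∑ j, ‖A i j‖) * d := by rw [Finset.sum_mul]
    _ ≤ _ := mul_le_mul_of_nonneg_right h1 hd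

variable {n₁ n₂ n : ℕ}

lemma hankel_add (hn : n + 1 = n₁ + n₂) (x y : Fin n → ℂ) :
    hankel hn (x + y) = hankel hn x + hankel hn y := by
  ext i j; simp [hankel]

lemma hankel_row (hn : n + 1 = n₁ + n₂) (v : Fin n → ℂ) {C : ℝ} (h : ∑ t, ‖v t‖ ≤ C) (i : Fin n₁) :
    ∑ j, ‖hankel hn v i j‖ ≤ C := by
  refine le_trans ?_ h
  have hinj : Function.Injective (fun j : Fin n₂ => (⟨i.1 + j.1, by omega⟩ : Fin n)) := by
    intro a b hab
    have := congrArg Fin.val hab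
    simp only at this
    exact Fin.ext (by omega)
  have e : ∑ j, ‖hankel hn v i j‖ = ∑ t ∈ Finset.univ.map ⟨_, hinj⟩, ‖v t‖ := by
    rw [Finset.sum_map]; rfl
  rw [e]
  exact Finset.sum_le_univ_sum_of_nonneg fun _ => norm_nonneg _

lemma hankel_col (hn : n + 1 = n₁ + n₂) (v : Fin n → ℂ) {C : ℝ} (h : ∑ t, ‖v t‖ ≤ C) (j : Fin n₂) :
    ∑ i, ‖hankel hn v i j‖ ≤ C := by
  refine le_trans ?_ h
  have hinj : Function.Injective (fun i : Fin n₁ => (⟨i.1 + j.1, by omega⟩ : Fin n)) := by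
    intro a b hab
    have := congrArg Fin.val hab
    simp only at this
    exact Fin.ext (by omega)
  have e : ∑ i, ‖hankel hn v i j‖ = ∑ t ∈ Finset.univ.map ⟨_, hinj⟩, ‖v t‖ := by
    rw [Finset.sum_map]; rfl
  rw [e]
  exact Finset.sum_le_univ_sum_of_nonneg fun _ => norm_nonneg _

lemma dagger_bound (hn : n + 1 = n₁ + n₂) (x : Fin n → ℂ) (A : Matrix (Fin n₁) (Fin n₂) ℂ)
    {B : ℝ} (h1 : 0 < n₁) (h2 : 0 < n₂)
    (h : ∀ i j, ‖(hankel hn x - A) i j‖ ≤ B) (t : Fin n) :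
    ‖(x - hankelDagger hn A) t‖ ≤ B := by
  classical
  set F := Finset.univ.filter fun p : Fin n₁ × Fin n₂ => p.1.1 + p.2.1 = t.1 with hF
  have hne : F.Nonempty := by
    have ht := t.2
    refine ⟨(⟨min t.1 (n₁ - 1), by omega⟩, ⟨t.1 - min t.1 (n₁ - 1), by omega⟩), ?_⟩
    rw [hF, Finset.mem_filter]
    refine ⟨Finset.mem_univ _, ?_⟩
    simp only; omega
  have hc : (F.card : ℂ) ≠ 0 := by exact_mod_cast hne.card_pos.ne'
  have hc' : (0 : ℝ) < F.card := by exact_mod_cast hne.card_pos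
  have e : (x - hankelDagger hn A) t = (F.card : ℂ)⁻¹ * ∑ p ∈ F, (hankel hn x - A) p.1 p.2 := by
    have e1 : ∑ p ∈ F, hankel hn x p.1 p.2 = F.card * x t := by
      rw [Finset.sum_congr rfl (g := fun _ => x t), Finset.sum_const, nsmul_eq_mul]
      intro p hp
      rw [hF, Finset.mem_filter] at hp
      simp only [hankel, Matrix.of_apply]
      congr 1
      exact Fin.ext hp.2
    have e2 : hankelDagger hn A t = (F.card : ℂ)⁻¹ * ∑ p ∈ F, A p.1 p.2 := by
      unfold hankelDagger
      rw [hF]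
    rw [Pi.sub_apply, e2]
    simp only [Matrix.sub_apply, Finset.sum_sub_distrib]
    rw [e1, mul_sub, inv_mul_cancel_left₀ hc]
  rw [e, norm_mul, norm_inv, Complex.norm_natCast]
  have s1 : ‖∑ p ∈ F, (hankel hn x - A) p.1 p.2‖ ≤ F.card * B := by
    refine (norm_sum_le _ _).trans ?_
    refine (Finset.sum_le_card_nsmul _ _ B fun p _ => h _ _).trans ?_
    rw [nsmul_eq_mul]
  calc _ ≤ (F.card : ℝ)⁻¹ * (F.card * B) := by gcongr
    _ = B := by field_simp

lemma thr (x s xk : Fin n → ℂ) {X ζ : ℝ} (hX : ∀ t, ‖(x - xk) t‖ ≤ X) (hX0 : 0 ≤ X) (hζ : X ≤ ζ) (t : Fin n) :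
    (s t = 0 → (s - hardThreshold ζ (x + s - xk)) t = 0) ∧
      ‖(s - hardThreshold ζ (x + s - xk)) t‖ ≤ X + ζ := by
  have h1 := hX t
  simp only [Pi.sub_apply, Pi.add_apply, hardThreshold] at *
  split_ifs with hc
  · constructor
    · intro h0
      rw [h0, add_zero] at hc
      linarith
    · have : s t - (x t + s t - xk t) = -(x t - xk t) := by ring
      rw [this, norm_neg]
      linarith
  · constructor
    · intro h0; rw [h0, sub_zero]
    · push Not at hc
      have : s t - 0 = (x t + s t - xk t) - (x t - xk t) := by ring
      rw [this]
      refine (norm_sub_le _ _).trans ?_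
      linarith

lemma sparse_sum {α : ℝ} (s v : Fin n → ℂ) (hs : IsSparse α s) {e : ℝ} (he : 0 ≤ e)
    (h0 : ∀ t, s t = 0 → v t = 0) (h1 : ∀ t, ‖v t‖ ≤ e) : ∑ t, ‖v t‖ ≤ α * n * e := by
  classical
  have e1 : ∑ t, ‖v t‖ = ∑ t ∈ supp s, ‖v t‖ := by
    symm
    apply Finset.sum_subset (Finset.subset_univ _)
    intro t _ ht
    have : s t = 0 := by
      by_contra hc
      exact ht (by simp [supp, hc])
    rw [h0 t this, norm_zero]
  rw [e1]
  calc _ ≤ (supp s).card • e := Finset.sum_le_card_nsmul _ _ _ fun t _ => h1 t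
    _ = ((supp s).card : ℝ) * e := by rw [nsmul_eq_mul]
    _ ≤ _ := mul_le_mul_of_nonneg_right hs he

end hankelsec

section onestep

lemma row_proj {m : Type*} [Fintype m] [DecidableEq m] {r : ℕ} {U : Matrix m (Fin r) ℂ}
    (hU : Uᴴ * U = 1) {b : ℝ} (i : m) (h : ‖er i * U‖ ≤ b) : ‖er i * (U * Uᴴ)‖ ≤ b := by
  have := nmul h (B := Uᴴ) (b := 1) (by rw [nct]; exact iso_norm hU)
  rwa [Matrix.mul_assoc, mul_one] at this

lemma row_proj' {m : Type*} [Fintype m] [DecidableEq m] {r : ℕ} {U : Matrix m (Fin r) ℂ}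
    (hU : Uᴴ * U = 1) {b : ℝ} (i : m) (h : ‖er i * (U * Uᴴ)‖ ≤ b) : ‖er i * U‖ ≤ b := by
  have := nmul h (iso_norm hU)
  rw [Matrix.mul_assoc, Matrix.mul_assoc, hU, mul_one, Matrix.mul_one] at this
  exact this

lemma svd_last {m n : Type*} [Fintype m] [Fintype n] {r : ℕ} (hr : 0 < r)
    {L : Matrix m n ℂ} {U : Matrix m (Fin r) ℂ} {σ : Fin r → ℝ}
    {V : Matrix n (Fin r) ℂ} (h : IsSVD L U σ V) (i : Fin r) : σ ⟨r - 1, by omega⟩ ≤ σ i :=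
  h.2.2.2.1 _ _ (by rw [Fin.le_def]; simp only; omega)

lemma one_step {n₁ n₂ n r : ℕ} (hn : n + 1 = n₁ + n₂) (hr : 0 < r)
    {x v : Fin n → ℂ} {Lk L' : Matrix (Fin n₁) (Fin n₂) ℂ}
    {U Uk U' : Matrix (Fin n₁) (Fin r) ℂ} {σ σk σ' : Fin r → ℝ} {V Vk V' : Matrix (Fin n₂) (Fin r) ℂ}
    {κ τ S w b : ℝ}
    (hL : IsSVD (hankel hn x) U σ V) (hk : IsSVD Lk Uk σk Vk) (h' : IsSVD L' U' σ' V')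
    (hS : 0 < S) (hσ : ∀ i, S ≤ σ i) (hσ0 : σ ⟨0, hr⟩ = κ * S) (hb : 0 ≤ b)
    (hw : 0 ≤ w) (hwS : w ≤ S) (hκ : 1 ≤ κ) (hτ : 0 ≤ τ) (hκτ : κ * τ ≤ 1 / 1000)
    (hrτ : r * τ ≤ 1 / 1000)
    (rU : ∀ i : Fin n₁, ‖er i * U‖ ≤ b) (rV : ∀ j : Fin n₂, ‖er j * V‖ ≤ b)
    (rUk : ∀ i : Fin n₁, ‖er i * Uk‖ ≤ 2 * κ * b) (rVk : ∀ j : Fin n₂, ‖er j * Vk‖ ≤ 2 * κ * b)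
    (hv : ∑ t, ‖v t‖ ≤ τ * w / (4 * κ))
    (hbest : IsBestRankApprox r (tangentProj Uk Vk (hankel hn x + hankel hn v)) L')
    (hD : ‖hankel hn x - Lk‖ ≤ 2 * τ * w) :
    ‖hankel hn x - L'‖ ≤ 0.52 * (τ * w) ∧
      (∀ i j, ‖(hankel hn x - L') i j‖ ≤ 0.05 * (b ^ 2 * w)) ∧
      (∀ i : Fin n₁, ‖er i * U'‖ ≤ 2 * κ * b) ∧ (∀ j : Fin n₂, ‖er j * V'‖ ≤ 2 * κ * b) := by
  have hκ0 : 0 < κ := by linarith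
  have hC : 0 ≤ τ * w / (4 * κ) := by positivity
  have hκb : 0 ≤ 2 * κ * b := by positivity
  have hE : ‖hankel hn v‖ ≤ τ * w / (4 * κ) :=
    schur _ hC (hankel_row hn v hv) (hankel_col hn v hv)
  have pd := PD.of_svd hL hS hσ
  have pdk := PD.of_svd hk (hk.2.2.1 _) (svd_last hr hk)
  have mk : ∀ {S' : ℝ} (hS' : 0 < S') (hσ' : ∀ i, S' ≤ σ' i),
      Step r (hankel hn x) Lk L' (hankel hn v) (tangentProj Uk Vk (hankel hn x + hankel hn v))
        (U * Uᴴ) (Uk * Ukᴴ) (U' * U'ᴴ) (V * Vᴴ) (Vk * Vkᴴ) (V' * V'ᴴ) _ _ _ S _ S' κ τ w :=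
    fun {S'} hS' hσ' =>
      { pd := pd
        pdk := pdk
        pd' := PD.of_svd h' hS' hσ'
        hM := rfl
        PM := best_left (PD.of_svd h' hS' hσ') hbest
        MQ := best_right (PD.of_svd h' hS' hσ') hbest
        fb := hbest.2 _ (by
          rw [← pd.PL, Matrix.mul_assoc]
          exact (Matrix.rank_mul_le_left _ _).trans
            ((Matrix.rank_le_card_width _).trans (by simp)))
        hS := hS
        hw := hw
        hwS := hwS
        hκ := hκ
        hτ := hτ
        hκτ := hκτ
        hrτ := hrτ
        hD := hD
        hE := hE }
  have sp := (mk (h'.2.2.1 _) (svd_last hr h')).spec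
  have hsm : ‖hankel hn x - L'‖ ≤ 0.01 * S := by
    have t1 : τ ≤ 1 / 1000 := by nlinarith
    have : τ * w ≤ 1 / 1000 * S := mul_le_mul t1 hwS hw (by norm_num)
    linarith
  have hS' : ∀ i, 0.99 * S ≤ σ' i := fun i => by
    have := svd_weyl hL h' hS hσ (by linarith) i
    linarith
  have st := mk (by linarith : 0 < 0.99 * S) hS'
  have hLn : ‖hankel hn x‖ ≤ κ * S := by rw [svd_norm hL hr, hσ0]
  have hbE : τ * w / (4 * κ) * (2 * κ * b) ≤ b * (τ * w) := by
    have : τ * w / (4 * κ) * (2 * κ * b) = b * (τ * w) / 2 := by field_simp; ring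
    rw [this]
    have : 0 ≤ b * (τ * w) := by positivity
    linarith
  have fE : ∀ i : Fin n₁, ‖er i * hankel hn v * (Vk * Vkᴴ)‖ ≤ b * (τ * w) := fun i =>
    (row_comb _ _ hκb i (hankel_row hn v hv i) (fun j => row_proj hk.2.1 j (rVk j))).trans hbE
  have gE : ∀ j : Fin n₂, ‖er j * (hankel hn v)ᴴ * (Uk * Ukᴴ)‖ ≤ b * (τ * w) := fun j =>
    (row_comb _ _ hκb j (by
      simpa [Matrix.conjTranspose_apply] using hankel_col hn v hv j)
      (fun i => row_proj hk.1 i (rUk i))).trans hbE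
  have f1 : ∀ i : Fin n₁, ‖er i * (U * Uᴴ)‖ ≤ b := fun i => row_proj hL.1 i (rU i)
  have g1 : ∀ j : Fin n₂, ‖er j * (V * Vᴴ)‖ ≤ b := fun j => row_proj hL.2.1 j (rV j)
  have fk : ∀ i : Fin n₁, ‖er i * (Uk * Ukᴴ)‖ ≤ 2 * κ * b := fun i => row_proj hk.1 i (rUk i)
  have gk : ∀ j : Fin n₂, ‖er j * (Vk * Vkᴴ)‖ ≤ 2 * κ * b := fun j => row_proj hk.2.1 j (rVk j)
  have f' : ∀ i : Fin n₁, ‖er i * (U' * U'ᴴ)‖ ≤ 2 * κ * b := fun i =>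
    st.rowP' hb (er i) (f1 i) (fk i) (fE i) hLn le_rfl
  have g' : ∀ j : Fin n₂, ‖er j * (V' * V'ᴴ)‖ ≤ 2 * κ * b := fun j =>
    st.ct.rowP' hb (er j) (g1 j) (gk j) (gE j) (by rw [nct]; exact hLn) le_rfl
  refine ⟨sp, fun i j => ?_, fun i => row_proj' h'.1 i (f' i), fun j => row_proj' h'.2.1 j (g' j)⟩
  rw [← er_entry]
  refine st.entry hb (er i) (er j)ᴴ (f1 i) ?_ (f' i) ?_ ?_ ?_
  · rw [← nct, Matrix.conjTranspose_mul, Matrix.conjTranspose_conjTranspose, proj_herm]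
    exact g1 j
  · rw [← nct, Matrix.conjTranspose_mul, Matrix.conjTranspose_conjTranspose, proj_herm]
    exact g' j
  · exact st.rowPL hb (er i) (f1 i) (fk i) (fE i) (f' i)
  · have := st.ct.rowPL hb (er j) (g1 j) (gk j) (gE j) (g' j)
    rw [← nct, Matrix.conjTranspose_mul, Matrix.conjTranspose_mul, Matrix.conjTranspose_conjTranspose,
      Matrix.conjTranspose_sub, Matrix.conjTranspose_one, proj_herm]
    exact this

lemma incoh_transfer {m n' : Type*} [Fintype m] [Fintype n'] [DecidableEq m] [DecidableEq n']
    [Nonempty m] [Nonempty n'] {r n : ℕ} (hr : 0 < r) {μ cs b : ℝ}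
    {L : Matrix m n' ℂ} (h : IsIncoherent r n μ cs L) (hb : Real.sqrt (μ * cs * r / n) = b)
    {U : Matrix m (Fin r) ℂ} {σ : Fin r → ℝ} {V : Matrix n' (Fin r) ℂ} (hs : IsSVD L U σ V) :
    (∀ i : m, ‖er i * U‖ ≤ b) ∧ (∀ j : n', ‖er j * V‖ ≤ b) := by
  obtain ⟨U₁, σ₁, V₁, h1, hU, hV⟩ := h
  rw [hb, rowNorm_iff] at hU hV
  have p := PD.of_svd hs (hs.2.2.1 _) (svd_last hr hs)
  have p1 := PD.of_svd h1 (h1.2.2.1 _) (svd_last hr h1)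
  have e := p.uniq p1
  have e' := p.ct.uniq p1.ct
  constructor
  · intro i
    apply row_proj' hs.1
    rw [e]
    exact row_proj h1.1 i (hU i)
  · intro i
    apply row_proj' hs.2.1
    rw [e']
    exact row_proj h1.2.1 i (hV i)

end onestep


set_option maxHeartbeats 1000000 in
/-- Local Convergence of ASAP, Theorem 1 of the paper. -/
theorem statement0 :
    ∀ γ : ℝ, 1 / Real.sqrt 12 < γ → γ < 1 →
    ∃ c : ℝ, 0 < c ∧
    ∀ (n₁ n₂ n r : ℕ) (hn : n + 1 = n₁ + n₂), 0 < n₁ → 0 < n₂ → (hr : 0 < r) →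
    ∀ (μ α κ cs τ β : ℝ), 0 < μ → 0 < α →
    ∀ (x s : Fin n → ℂ)
      (U : Matrix (Fin n₁) (Fin r) ℂ) (σ : Fin r → ℝ) (V : Matrix (Fin n₂) (Fin r) ℂ),
      IsSVD (hankel hn x) U σ V →
      cs = csConst n₁ n₂ n →
      rowNorm U ≤ Real.sqrt (μ * cs * r / n) →
      rowNorm V ≤ Real.sqrt (μ * cs * r / n) →
      κ = σ ⟨0, hr⟩ / σ ⟨r - 1, by omega⟩ →
      IsSparse α s →
      α ≤ c / (μ * cs * r * κ) ^ 2 →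
      τ = 4 * α * μ * cs * r * κ →
      β = μ * cs * r / (2 * κ * n) →
    ∀ (Ls : ℕ → Matrix (Fin n₁) (Fin n₂) ℂ) (xs ss : ℕ → Fin n → ℂ)
      (Us : ℕ → Matrix (Fin n₁) (Fin r) ℂ) (σs : ℕ → Fin r → ℝ)
      (Vs : ℕ → Matrix (Fin n₂) (Fin r) ℂ),
      (∀ k, IsSVD (Ls k) (Us k) (σs k) (Vs k)) →
      xs 0 = hankelDagger hn (Ls 0) →
      (∀ k, ss (k + 1) = hardThreshold (β * γ ^ k * specNorm (Ls k)) (x + s - xs k)) →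
      (∀ k, IsBestRankApprox r
        (tangentProj (Us k) (Vs k) (hankel hn (x + s - ss (k + 1)))) (Ls (k + 1))) →
      (∀ k, xs (k + 1) = hankelDagger hn (Ls (k + 1))) →
      specNorm (hankel hn x - Ls 0) ≤ 2 * τ * σ ⟨r - 1, by omega⟩ →
      vecMaxNorm (x - xs 0) ≤ (τ - 2 * τ ^ 2) / (8 * α * κ * n) * σ ⟨r - 1, by omega⟩ →
      IsIncoherent r n (4 * μ * κ ^ 2) cs (Ls 0) →
      ∀ k : ℕ,
        specNorm (hankel hn x - Ls k) ≤ 2 * τ * γ ^ k * σ ⟨r - 1, by omega⟩ ∧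
        vecMaxNorm (x - xs k)
          ≤ (τ - 2 * τ ^ 2) / (8 * α * κ * n) * γ ^ k * σ ⟨r - 1, by omega⟩ ∧
        IsIncoherent r n (4 * μ * κ ^ 2) cs (Ls k) := by
  intro γ hγ hγ1
  refine ⟨1 / 4000, by norm_num, ?_⟩
  intro n₁ n₂ n r hn hn1 hn2 hr μ α κ cs τ β hμ hα x s U σ V hL hcs hU hV hκ hs hα' hτ hβ
    Ls xs ss Us σs Vs hSVD hx0 hss hbest hxs hb0 hb1 hb2
  have i1 : Nonempty (Fin n₁) := ⟨⟨0, hn1⟩⟩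
  have i2 : Nonempty (Fin n₂) := ⟨⟨0, hn2⟩⟩
  have hn0 : 0 < n := by omega
  have i3 : Nonempty (Fin n) := ⟨⟨0, hn0⟩⟩
  have hn0' : (0 : ℝ) < n := by exact_mod_cast hn0
  have hn1' : (0 : ℝ) < n₁ := by exact_mod_cast hn1
  have hr1 : (1 : ℝ) ≤ r := by exact_mod_cast hr
  have hcs0 : 0 < cs := by
    rw [hcs, csConst]
    exact lt_max_of_lt_left (by positivity)
  have hr0 : (0 : ℝ) < r := by linarith
  obtain ⟨S, hSdef⟩ : ∃ S, S = σ ⟨r - 1, by omega⟩ := ⟨_, rfl⟩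
  rw [← hSdef] at hκ hb0 hb1 ⊢
  have hS : 0 < S := hSdef ▸ hL.2.2.1 _
  have hσ : ∀ i, S ≤ σ i := fun i => hSdef ▸ svd_last hr hL i
  have hσ0 : σ ⟨0, hr⟩ = κ * S := by rw [hκ]; field_simp
  have hκ1 : 1 ≤ κ := by
    have := hσ ⟨0, hr⟩
    rw [hκ, le_div_iff₀ hS]; linarith
  have hκ0 : 0 < κ := by linarith
  obtain ⟨a, ha⟩ : ∃ a, a = μ * cs * r / n := ⟨_, rfl⟩
  have ha0 : 0 < a := by rw [ha]; positivity
  have hp : μ * cs * r = a * n := by rw [ha]; field_simp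
  rw [← ha] at hU hV
  have hba : Real.sqrt a ^ 2 = a := Real.sq_sqrt ha0.le
  have hbn : 0 ≤ Real.sqrt a := Real.sqrt_nonneg _
  rw [rowNorm_iff] at hU hV
  -- p ≥ r
  have hpr : (r : ℝ) ≤ a * n := by
    have e1 := frob_iso hL.1
    rw [frob_sq, Fintype.card_fin] at e1
    have e2 : ∑ i : Fin n₁, ‖er i * U‖ ^ 2 ≤ ∑ _i : Fin n₁, a :=
      Finset.sum_le_sum fun i _ => by
        rw [← hba]; exact pow_le_pow_left₀ (norm_nonneg _) (hU i) 2
    rw [e1] at e2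
    simp only [Finset.sum_const, Finset.card_univ, Fintype.card_fin, nsmul_eq_mul] at e2
    have : (n₁ : ℝ) ≤ n := by exact_mod_cast (by omega : n₁ ≤ n)
    nlinarith
  obtain ⟨p, hpd⟩ : ∃ p, p = a * n := ⟨_, rfl⟩
  have hτ' : τ = 4 * α * p * κ := by
    rw [hτ, hpd, ← hp]; ring
  rw [hp] at hα' hβ
  rw [← hpd] at hpr hα' hβ
  have hp1 : 1 ≤ p := by linarith
  have hp0 : 0 < p := by linarith
  have hτ0 : 0 < τ := by rw [hτ']; positivity
  have hmain : κ * τ * p ≤ 1 / 1000 := by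
    rw [le_div_iff₀ (by positivity)] at hα'
    have : κ * τ * p = 4 * (α * (p * κ) ^ 2) := by rw [hτ']; ring
    linarith
  have hκτ : κ * τ ≤ 1 / 1000 := by
    have : κ * τ * 1 ≤ κ * τ * p := mul_le_mul_of_nonneg_left hp1 (by positivity)
    linarith
  have hrτ : r * τ ≤ 1 / 1000 := by
    have e1 : τ * r ≤ τ * p := mul_le_mul_of_nonneg_left hpr hτ0.le
    have e2 : 1 * (τ * p) ≤ κ * (τ * p) := mul_le_mul_of_nonneg_right hκ1 (by positivity)
    nlinarith
  have hτs : τ ≤ 1 / 1000 := by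
    have : 1 * τ ≤ κ * τ := mul_le_mul_of_nonneg_right hκ1 hτ0.le
    linarith
  have hβ' : β = a / (2 * κ) := by
    rw [hβ, hpd]; field_simp
  have hco : (τ - 2 * τ ^ 2) / (8 * α * κ * n) = a / 2 * (1 - 2 * τ) := by
    have : τ - 2 * τ ^ 2 = τ * (1 - 2 * τ) := by ring
    rw [this, div_eq_iff (by positivity)]
    have : τ * (1 - 2 * τ) = 4 * α * (a * n) * κ * (1 - 2 * τ) := by
      rw [← hpd, ← hτ']
    rw [this]; ring
  rw [hco] at hb1 ⊢
  have hγ0 : 0.28 < γ := by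
    refine lt_trans ?_ hγ
    rw [lt_div_iff₀ (by positivity)]
    have : Real.sqrt 12 < 3.5 := by
      rw [Real.sqrt_lt' (by norm_num)]; norm_num
    linarith
  have hγp : 0 < γ := by linarith
  have hsq : Real.sqrt (4 * μ * κ ^ 2 * cs * r / n) = 2 * κ * Real.sqrt a := by
    have : 4 * μ * κ ^ 2 * cs * r / n = (2 * κ) ^ 2 * a := by rw [ha]; ring
    rw [this, Real.sqrt_mul (by positivity), Real.sqrt_sq (by positivity)]
  have hLn : ‖hankel hn x‖ = κ * S := by rw [svd_norm hL hr, hσ0]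
  intro k
  induction k with
  | zero =>
    refine ⟨by simpa using hb0, by simpa using hb1, hb2⟩
  | succ k ih =>
    obtain ⟨ih0, ih1, ih2⟩ := ih
    rw [specNorm_eq] at ih0
    obtain ⟨g, hg⟩ : ∃ g, g = γ ^ k := ⟨_, rfl⟩
    have hg0 : 0 < g := hg ▸ pow_pos hγp k
    have hg1 : g ≤ 1 := hg ▸ pow_le_one₀ hγp.le hγ1.le
    obtain ⟨w, hw⟩ : ∃ w, w = g * S := ⟨_, rfl⟩
    have hw0 : 0 < w := by rw [hw]; positivity
    have hwS : w ≤ S := by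
      have : g * S ≤ 1 * S := mul_le_mul_of_nonneg_right hg1 hS.le
      linarith
    rw [← hg] at ih0 ih1
    have hD : ‖hankel hn x - Ls k‖ ≤ 2 * τ * w := by
      rw [hw]; linarith
    have hX : ∀ t, ‖(x - xs k) t‖ ≤ a / 2 * (1 - 2 * τ) * w := fun t => by
      have e := le_ciSup (f := fun t => ‖(x - xs k) t‖) (Set.finite_range _).bddAbove t
      unfold vecMaxNorm at ih1
      have e2 := e.trans ih1
      rw [hw]; linarith
    obtain ⟨ζ, hζ⟩ : ∃ ζ, ζ = β * γ ^ k * specNorm (Ls k) := ⟨_, rfl⟩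
    have hNs : 2 * τ * w ≤ 2 * τ * S := mul_le_mul_of_nonneg_left hwS (by positivity)
    have hN1 : κ * S - 2 * τ * S ≤ ‖Ls k‖ := by
      have := norm_sub_norm_le (hankel hn x) (Ls k)
      linarith
    have hN2 : ‖Ls k‖ ≤ κ * S + 2 * τ * S := by
      have := norm_sub_norm_le (Ls k) (hankel hn x)
      rw [norm_sub_rev] at this
      linarith
    have hζ' : ζ = a / (2 * κ) * g * ‖Ls k‖ := by rw [hζ, hβ', ← hg, specNorm_eq]
    have hpos : 0 ≤ a / (2 * κ) * g := by positivity
    have hτκ : τ / κ ≤ τ := div_le_self hτ0.le hκ1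
    have haw : 0 ≤ a * w := by positivity
    have hτκ2 : a * w * (τ / κ) ≤ a * w * τ := mul_le_mul_of_nonneg_left hτκ haw
    have hζ1 : a / 2 * (1 - 2 * τ) * w ≤ ζ := by
      have e := mul_le_mul_of_nonneg_left hN1 hpos
      have e2 : a / (2 * κ) * g * (κ * S - 2 * τ * S) = a * w / 2 - a * w * (τ / κ) := by
        rw [hw]; field_simp
      rw [e2] at e
      rw [hζ']; linarith
    have hζ2 : ζ ≤ a / 2 * (1 + 2 * τ) * w := by
      have e := mul_le_mul_of_nonneg_left hN2 hpos
      have e2 : a / (2 * κ) * g * (κ * S + 2 * τ * S) = a * w / 2 + a * w * (τ / κ) := by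
        rw [hw]; field_simp
      rw [e2] at e
      rw [hζ']; linarith
    have hX0 : 0 ≤ a / 2 * (1 - 2 * τ) * w := by
      have : 0 ≤ 1 - 2 * τ := by linarith
      positivity
    have hth := thr x s (xs k) hX hX0 hζ1
    rw [hζ, ← hss k] at hth
    rw [← hζ] at hth
    have hv : ∑ t, ‖(s - ss (k + 1)) t‖ ≤ τ * w / (4 * κ) := by
      refine (sparse_sum s _ hs haw (fun t => (hth t).1)
        (fun t => (hth t).2.trans (by linarith))).trans (le_of_eq ?_)
      rw [eq_div_iff (by positivity), hτ', hpd]; ring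
    have hbk := hbest k
    rw [add_sub_assoc, hankel_add] at hbk
    obtain ⟨rUk, rVk⟩ := incoh_transfer hr ih2 hsq (hSVD k)
    obtain ⟨o1, o2, o3, o4⟩ := one_step hn hr hL (hSVD k) (hSVD (k + 1)) hS hσ hσ0 hbn hw0.le hwS
      hκ1 hτ0.le hκτ hrτ hU hV rUk rVk hv hbk hD
    rw [hba] at o2
    have hgw : γ ^ (k + 1) * S = γ * w := by rw [pow_succ, hw, hg]; ring
    have hgw' : 0.28 * w ≤ γ * w := mul_le_mul_of_nonneg_right hγ0.le hw0.le
    refine ⟨?_, ?_, Us (k + 1), σs (k + 1), Vs (k + 1), hSVD (k + 1), ?_, ?_⟩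
    · rw [specNorm_eq, mul_assoc, hgw]
      refine o1.trans ?_
      have := mul_le_mul_of_nonneg_left hgw' hτ0.le
      have : 0 < τ * w := by positivity
      nlinarith
    · rw [mul_assoc, hgw, hxs k]
      refine ciSup_le fun t => (dagger_bound hn x _ hn1 hn2 o2 t).trans ?_
      have e1 := mul_le_mul_of_nonneg_left hgw' ha0.le
      have e3 : 0.99 * (a / 2 * (γ * w)) ≤ (1 - 2 * τ) * (a / 2 * (γ * w)) :=
        mul_le_mul_of_nonneg_right (by linarith) (by positivity)
      nlinarith
    · rw [hsq, rowNorm_iff]; exact o3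
    · rw [hsq, rowNorm_iff]; exact o4

end ASAP
end
end

section
/- Let n = n₁ + n₂ − 1, let s ∈ ℂⁿ be α-sparse, and let L_k ∈ ℂ^{n₁×n₂} be a rank-r matrix that is 4μκ²-incoherent, i.e. its SVD factors satisfy ‖U_k‖_{2,∞} ≤ √(4μ c_s r κ²/n) and ‖V_k‖_{2,∞} ≤ √(4μ c_s r κ²/n). Let T_k be the tangent space of L_k and P_{T_k} the orthogonal projection onto T_k. If s' ∈ ℂⁿ satisfies supp(s') ⊆ supp(s), then ‖P_{T_k} ℋ(s − s')‖_∞ ≤ 12 α μ c_s r κ² ‖s − s'‖_∞. -/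
open Matrix
open scoped BigOperators

noncomputable section

namespace ASAP

theorem proj_facts {m : Type*} [Fintype m] {r : ℕ} (U : Matrix m (Fin r) ℂ) (B : ℝ)
    (hU : Uᴴ * U = 1) (hB : ∀ i, ∑ j, ‖U i j‖ ^ 2 ≤ B) :
    (∀ i k, ‖(U * Uᴴ) i k‖ ≤ B) ∧ (∀ i, ∑ k, ‖(U * Uᴴ) i k‖ ^ 2 ≤ B) ∧
    (∀ i k, ‖(U * Uᴴ) k i‖ = ‖(U * Uᴴ) i k‖) := by
  have hdiag : ∀ i k, ‖(U * Uᴴ) i k‖ ≤ B := by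
    intro i k
    have h1 : ‖(U * Uᴴ) i k‖ ≤ ∑ j, (‖U i j‖ ^ 2 + ‖U k j‖ ^ 2) / 2 := by
      rw [Matrix.mul_apply]
      refine (norm_sum_le _ _).trans (Finset.sum_le_sum fun j _ => ?_)
      rw [norm_mul, Matrix.conjTranspose_apply, norm_star]
      nlinarith [sq_nonneg (‖U i j‖ - ‖U k j‖)]
    rw [← Finset.sum_div, Finset.sum_add_distrib] at h1
    linarith [hB i, hB k]
  have hsym : (U * Uᴴ)ᴴ = U * Uᴴ := by simp
  have hid : (U * Uᴴ) * (U * Uᴴ)ᴴ = U * Uᴴ := by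
    rw [hsym, Matrix.mul_assoc, ← Matrix.mul_assoc Uᴴ, hU, Matrix.one_mul]
  refine ⟨hdiag, fun i => ?_, fun i k => ?_⟩
  · have h2 := congrFun (congrFun hid i) i
    rw [Matrix.mul_apply] at h2
    have h3 : ((∑ k, ‖(U * Uᴴ) i k‖ ^ 2 : ℝ) : ℂ) = (U * Uᴴ) i i := by
      rw [← h2]
      push_cast
      refine Finset.sum_congr rfl fun k _ => ?_
      rw [Matrix.conjTranspose_apply]
      exact (Complex.mul_conj' _).symm
    have h4 := hdiag i i
    rw [← h3, Complex.norm_real] at h4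
    exact (le_abs_self _).trans h4
  · have h2 := congrFun (congrFun hsym i) k
    rw [← h2, Matrix.conjTranspose_apply, norm_star]

theorem tangent_bound {m n : Type*} [Fintype m] [Fintype n] {r : ℕ}
    (U : Matrix m (Fin r) ℂ) (V : Matrix n (Fin r) ℂ) (M : Matrix m n ℂ) (B S : ℝ)
    (hB0 : 0 ≤ B) (hS0 : 0 ≤ S)
    (hU : Uᴴ * U = 1) (hV : Vᴴ * V = 1)
    (hUB : ∀ i, ∑ j, ‖U i j‖ ^ 2 ≤ B) (hVB : ∀ i, ∑ j, ‖V i j‖ ^ 2 ≤ B)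
    (hr : ∀ i, ∑ j, ‖M i j‖ ≤ S) (hc : ∀ j, ∑ i, ‖M i j‖ ≤ S) (i : m) (j : n) :
    ‖tangentProj U V M i j‖ ≤ 3 * (S * B) := by
  obtain ⟨hP1, hP2, -⟩ := proj_facts U B hU hUB
  obtain ⟨hQ1, hQ2, hQ3⟩ := proj_facts V B hV hVB
  unfold tangentProj
  generalize U * Uᴴ = P at *
  generalize V * Vᴴ = Q at *
  have h1 : ‖(P * M) i j‖ ≤ S * B := by
    rw [Matrix.mul_apply]
    calc _ ≤ ∑ k, ‖M k j‖ * B := by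
          refine (norm_sum_le _ _).trans (Finset.sum_le_sum fun k _ => ?_)
          rw [norm_mul, mul_comm]
          exact mul_le_mul_of_nonneg_left (hP1 i k) (norm_nonneg _)
      _ ≤ S * B := by
          rw [← Finset.sum_mul]
          exact mul_le_mul_of_nonneg_right (hc j) hB0
  have h2 : ‖(M * Q) i j‖ ≤ S * B := by
    rw [Matrix.mul_apply]
    calc _ ≤ ∑ k, ‖M i k‖ * B := by
          refine (norm_sum_le _ _).trans (Finset.sum_le_sum fun k _ => ?_)
          rw [norm_mul]
          exact mul_le_mul_of_nonneg_left (hQ1 k j) (norm_nonneg _)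
      _ ≤ S * B := by
          rw [← Finset.sum_mul]
          exact mul_le_mul_of_nonneg_right (hr i) hB0
  have h3 : ‖(P * M * Q) i j‖ ≤ S * B := by
    have e : ‖(P * M * Q) i j‖ ≤
        ∑ l, ∑ k, (‖M k l‖ * ‖P i k‖ ^ 2 / 2 + ‖M k l‖ * ‖Q j l‖ ^ 2 / 2) := by
      rw [Matrix.mul_apply]
      refine (norm_sum_le _ _).trans (Finset.sum_le_sum fun l _ => ?_)
      rw [Matrix.mul_apply, Finset.sum_mul]
      refine (norm_sum_le _ _).trans (Finset.sum_le_sum fun k _ => ?_)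
      rw [norm_mul, norm_mul, hQ3 j l]
      nlinarith [mul_nonneg (norm_nonneg (M k l)) (sq_nonneg (‖P i k‖ - ‖Q j l‖))]
    have e1 : ∑ l, ∑ k, ‖M k l‖ * ‖P i k‖ ^ 2 / 2 ≤ S * B / 2 := by
      rw [Finset.sum_comm]
      calc _ ≤ ∑ k, S * ‖P i k‖ ^ 2 / 2 := by
            refine Finset.sum_le_sum fun k _ => ?_
            rw [← Finset.sum_div, ← Finset.sum_mul]
            have := hr k
            gcongr
        _ ≤ S * B / 2 := by
            rw [← Finset.sum_div, ← Finset.mul_sum]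
            have := hP2 i
            gcongr
    have e2 : ∑ l, ∑ k, ‖M k l‖ * ‖Q j l‖ ^ 2 / 2 ≤ S * B / 2 := by
      calc _ ≤ ∑ l, S * ‖Q j l‖ ^ 2 / 2 := by
            refine Finset.sum_le_sum fun k _ => ?_
            rw [← Finset.sum_div, ← Finset.sum_mul]
            have := hc k
            gcongr
        _ ≤ S * B / 2 := by
            rw [← Finset.sum_div, ← Finset.mul_sum]
            have := hQ2 j
            gcongr
    simp only [Finset.sum_add_distrib] at e
    linarith
  rw [Matrix.sub_apply, Matrix.add_apply]
  have := norm_sub_le ((P * M) i j + (M * Q) i j) ((P * M * Q) i j)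
  have := norm_add_le ((P * M) i j) ((M * Q) i j)
  linarith

theorem rowNorm_sq {m : Type*} [Fintype m] {r : ℕ} (U : Matrix m (Fin r) ℂ) (B : ℝ)
    (h : rowNorm U ≤ Real.sqrt B) (i : m) : ∑ j, ‖U i j‖ ^ 2 ≤ max B 0 := by
  have h1 : Real.sqrt (∑ j, ‖U i j‖ ^ 2) ≤ Real.sqrt B :=
    (le_ciSup (f := fun i => Real.sqrt (∑ j, ‖U i j‖ ^ 2))
      (Set.finite_range _).bddAbove i).trans h
  have h0 : 0 ≤ ∑ j, ‖U i j‖ ^ 2 := by positivity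
  rcases le_total B 0 with hB | hB
  · rw [Real.sqrt_eq_zero_of_nonpos hB] at h1
    exact (Real.sqrt_eq_zero'.1 (le_antisymm h1 (Real.sqrt_nonneg _))).trans (le_max_right _ _)
  · exact ((Real.sqrt_le_sqrt_iff hB).1 h1).trans (le_max_left _ _)

theorem maxNorm_le {m n : Type*} [Fintype m] [Fintype n] (M : Matrix m n ℂ) (C : ℝ)
    (hC : 0 ≤ C) (h : ∀ i j, ‖M i j‖ ≤ C) : maxNorm M ≤ C :=
  Real.iSup_le (fun i => Real.iSup_le (fun j => h i j) hC) hC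

/-- entrywise bound for the tangent space projection of the Hankel
matrix of a sparse difference. -/
theorem statement8 {n₁ n₂ n r : ℕ} (hn : n + 1 = n₁ + n₂) (α μ κ : ℝ)
    (s s' : Fin n → ℂ) (hs : IsSparse α s)
    (Lk : Matrix (Fin n₁) (Fin n₂) ℂ)
    (Uk : Matrix (Fin n₁) (Fin r) ℂ) (σk : Fin r → ℝ) (Vk : Matrix (Fin n₂) (Fin r) ℂ)
    (hsvd : IsSVD Lk Uk σk Vk)
    (hUk : rowNorm Uk ≤ Real.sqrt (4 * μ * κ ^ 2 * csConst n₁ n₂ n * r / n))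
    (hVk : rowNorm Vk ≤ Real.sqrt (4 * μ * κ ^ 2 * csConst n₁ n₂ n * r / n))
    (hsupp : supp s' ⊆ supp s) :
    maxNorm (tangentProj Uk Vk (hankel hn (s - s')))
      ≤ 12 * α * μ * csConst n₁ n₂ n * r * κ ^ 2 * vecMaxNorm (s - s') := by
  obtain ⟨hU, hV, -, -, -⟩ := hsvd
  rcases Nat.eq_zero_or_pos r with hr | hr
  · subst hr
    have : tangentProj Uk Vk (hankel hn (s - s')) = 0 := by
      have h1 : Uk * Ukᴴ = 0 := by ext i j; simp [Matrix.mul_apply]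
      have h2 : Vk * Vkᴴ = 0 := by ext i j; simp [Matrix.mul_apply]
      simp [tangentProj, h1, h2]
    rw [this]
    refine maxNorm_le _ _ (by simp) (by simp)
  set B := 4 * μ * κ ^ 2 * csConst n₁ n₂ n * r / n with hBdef
  have hUB := rowNorm_sq Uk B hUk
  have hVB := rowNorm_sq Vk B hVk
  have hB : 0 < B := by
    by_contra hB
    rw [max_eq_right (not_lt.1 hB)] at hUB
    have hz : Uk = 0 := by
      ext i j
      have h1 := Finset.single_le_sum (f := fun j => ‖Uk i j‖ ^ 2)
        (fun _ _ => by positivity) (Finset.mem_univ j)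
      have h2 : ‖Uk i j‖ ^ 2 ≤ 0 := h1.trans (hUB i)
      have h3 : ‖Uk i j‖ ^ 2 = 0 := le_antisymm h2 (by positivity)
      simpa using h3
    rw [hz] at hU
    have := congrFun (congrFun hU ⟨0, hr⟩) ⟨0, hr⟩
    simp at this
  rw [max_eq_left hB.le] at hUB hVB
  have hn0 : (n : ℝ) ≠ 0 := by
    intro h
    rw [hBdef, h] at hB
    simp at hB
  set x := s - s' with hx
  have hX0 : 0 ≤ vecMaxNorm x := Real.iSup_nonneg fun _ => norm_nonneg _
  have hS : ∑ t, ‖x t‖ ≤ α * n * vecMaxNorm x := by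
    have h1 : ∑ t, ‖x t‖ = ∑ t ∈ supp s, ‖x t‖ := by
      symm
      refine Finset.sum_subset (Finset.subset_univ _) fun t _ ht => ?_
      have h2 : t ∉ supp s' := fun h => ht (hsupp h)
      simp only [supp, Finset.mem_filter, Finset.mem_univ, true_and, not_not] at ht h2
      simp [hx, ht, h2]
    have h2 : ∑ t ∈ supp s, ‖x t‖ ≤ (supp s).card • vecMaxNorm x :=
      Finset.sum_le_card_nsmul _ _ _ fun t _ =>
        le_ciSup (f := fun t => ‖x t‖) (Set.finite_range _).bddAbove t
    rw [h1]
    refine h2.trans ?_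
    rw [nsmul_eq_mul]
    exact mul_le_mul_of_nonneg_right hs hX0
  have hS0 : 0 ≤ α * n * vecMaxNorm x := le_trans (by positivity) hS
  have hrow : ∀ i, ∑ j, ‖hankel hn x i j‖ ≤ α * n * vecMaxNorm x := by
    intro i
    refine le_trans ?_ hS
    let f : Fin n₂ → Fin n := fun j => ⟨i.1 + j.1, by have hi := i.2; have hj := j.2; omega⟩
    have hf : Function.Injective f := by
      intro a b h
      simp only [f, Fin.mk.injEq] at h
      ext; omega
    calc _ = ∑ j, ‖x (f j)‖ := rfl
      _ = ∑ t ∈ Finset.univ.map ⟨f, hf⟩, ‖x t‖ := by rw [Finset.sum_map]; rfl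
      _ ≤ _ := Finset.sum_le_sum_of_subset_of_nonneg (Finset.subset_univ _)
          fun _ _ _ => norm_nonneg _
  have hcol : ∀ j, ∑ i, ‖hankel hn x i j‖ ≤ α * n * vecMaxNorm x := by
    intro j
    refine le_trans ?_ hS
    let f : Fin n₁ → Fin n := fun i => ⟨i.1 + j.1, by have hi := i.2; have hj := j.2; omega⟩
    have hf : Function.Injective f := by
      intro a b h
      simp only [f, Fin.mk.injEq] at h
      ext; omega
    calc _ = ∑ j, ‖x (f j)‖ := rfl
      _ = ∑ t ∈ Finset.univ.map ⟨f, hf⟩, ‖x t‖ := by rw [Finset.sum_map]; rfl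
      _ ≤ _ := Finset.sum_le_sum_of_subset_of_nonneg (Finset.subset_univ _)
          fun _ _ _ => norm_nonneg _
  have hfin : 12 * α * μ * csConst n₁ n₂ n * r * κ ^ 2 * vecMaxNorm x
      = 3 * (α * n * vecMaxNorm x * B) := by
    rw [hBdef]; field_simp; ring
  rw [hfin]
  exact maxNorm_le _ _ (by positivity)
    (tangent_bound Uk Vk _ B _ hB.le hS0 hU hV hUB hVB hrow hcol)

end ASAP
end
end

section
/- Let M ∈ ℂ^{n₁×n₂} be a rank-r matrix and let T be the tangent space at M (the direct sum of its column and row spaces), with orthogonal projection P_T. Then for every Z ∈ ℂ^{n₁×n₂}, ‖P_T Z‖₂ ≤ √(4/3) ‖Z‖₂. -/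
open Matrix
open scoped BigOperators

noncomputable section

namespace ASAP

theorem aux_pyth {E : Type*} [NormedAddCommGroup E] [InnerProductSpace ℂ E]
    (p : E →ₗ[ℂ] E) (hs : p.IsSymmetric) (hi : ∀ x, p (p x) = p x) (y z : E) :
    ‖p y + (z - p z)‖ ^ 2 = ‖p y‖ ^ 2 + ‖z - p z‖ ^ 2 := by
  have h : inner ℂ (p y) (z - p z) = 0 := by
    rw [hs y (z - p z), map_sub, hi, sub_self, inner_zero_right]
  have := norm_add_sq_eq_norm_sq_add_norm_sq_of_inner_eq_zero (p y) (z - p z) h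
  simpa only [sq] using this

theorem aux_ineq {E : Type*} [NormedAddCommGroup E] (u v : E) :
    ‖u + v‖ ^ 2 ≤ 2 * (‖u‖ ^ 2 + ‖v‖ ^ 2) := by
  have h := norm_add_le u v
  nlinarith [norm_nonneg (u + v), sq_nonneg (‖u‖ - ‖v‖)]

theorem aux_main {E F : Type*} [NormedAddCommGroup E] [InnerProductSpace ℂ E]
    [NormedAddCommGroup F] [InnerProductSpace ℂ F]
    (p : F →ₗ[ℂ] F) (hps : p.IsSymmetric) (hpi : ∀ x, p (p x) = p x)
    (q : E →ₗ[ℂ] E) (hqs : q.IsSymmetric) (hqi : ∀ x, q (q x) = q x)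
    (T : E →ₗ[ℂ] F) (C : ℝ) (hC : 0 ≤ C) (hT : ∀ x, ‖T x‖ ≤ C * ‖x‖) (x : E) :
    ‖p (T x) + (T (q x) - p (T (q x)))‖ ≤ Real.sqrt (4 / 3) * C * ‖x‖ := by
  have hsq : ∀ x, ‖T x‖ ^ 2 ≤ C ^ 2 * ‖x‖ ^ 2 := fun x => by
    rw [← mul_pow]; exact pow_le_pow_left₀ (norm_nonneg _) (hT x) 2
  have hself : ∀ y, ‖y‖ ^ 2 = ‖p y‖ ^ 2 + ‖y - p y‖ ^ 2 := fun y => by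
    rw [← aux_pyth p hps hpi, add_sub_cancel]
  have hx : ‖x‖ ^ 2 = ‖q x‖ ^ 2 + ‖x - q x‖ ^ 2 := by
    rw [← aux_pyth q hqs hqi, add_sub_cancel]
  have h1 := hsq x
  have h2 := hsq (q x)
  have h3 := hsq (x - q x)
  rw [hself] at h1 h2 h3
  have e1 := aux_ineq (p (T (q x))) (p (T (x - q x)))
  rw [← map_add, ← map_add, add_sub_cancel] at e1
  have e2 := aux_ineq (T x - p (T x)) (-(T (x - q x) - p (T (x - q x))))
  rw [norm_neg] at e2
  have e3 : T x - p (T x) + -(T (x - q x) - p (T (x - q x))) = T (q x) - p (T (q x)) := by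
    simp only [map_sub]; abel
  rw [e3] at e2
  refine (sq_le_sq₀ (norm_nonneg _) (by positivity)).1 ?_
  rw [aux_pyth p hps hpi, mul_pow, mul_pow, Real.sq_sqrt (by norm_num)]
  have hx' : C ^ 2 * ‖x‖ ^ 2 = C ^ 2 * ‖q x‖ ^ 2 + C ^ 2 * ‖x - q x‖ ^ 2 := by
    rw [hx]; ring
  linarith

theorem aux_proj {n r : ℕ} (U : Matrix (Fin n) (Fin r) ℂ) (h : Uᴴ * U = 1) :
    (Matrix.toEuclideanLin (U * Uᴴ)).IsSymmetric ∧
      ∀ x, Matrix.toEuclideanLin (U * Uᴴ) (Matrix.toEuclideanLin (U * Uᴴ) x) =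
        Matrix.toEuclideanLin (U * Uᴴ) x := by
  constructor
  · exact Matrix.isSymmetric_toEuclideanLin_iff.2 (Matrix.isHermitian_mul_conjTranspose_self U)
  · intro x
    simp only [Matrix.toLpLin_apply, Matrix.mulVec_mulVec]
    rw [Matrix.mul_assoc U, ← Matrix.mul_assoc Uᴴ, h, Matrix.one_mul]

/-- spectral norm bound for the tangent space projection. -/
theorem statement9 {n₁ n₂ r : ℕ} (M : Matrix (Fin n₁) (Fin n₂) ℂ)
    (U : Matrix (Fin n₁) (Fin r) ℂ) (σ : Fin r → ℝ) (V : Matrix (Fin n₂) (Fin r) ℂ)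
    (hsvd : IsSVD M U σ V) (Z : Matrix (Fin n₁) (Fin n₂) ℂ) :
    specNorm (tangentProj U V Z) ≤ Real.sqrt (4 / 3) * specNorm Z := by
  obtain ⟨hU, hV, -⟩ := hsvd
  obtain ⟨hps, hpi⟩ := aux_proj U hU
  obtain ⟨hqs, hqi⟩ := aux_proj V hV
  unfold specNorm
  refine ContinuousLinearMap.opNorm_le_bound _ (by positivity) fun x => ?_
  have := aux_main _ hps hpi _ hqs hqi (Matrix.toEuclideanLin Z) _ (norm_nonneg _)
    (fun x => (LinearMap.toContinuousLinearMap (Matrix.toEuclideanLin Z)).le_opNorm x) x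
  refine le_of_eq_of_le (congrArg norm ?_) this
  simp only [LinearMap.coe_toContinuousLinearMap', Matrix.toLpLin_apply, Matrix.mulVec_mulVec,
    tangentProj, Matrix.add_mulVec, Matrix.sub_mulVec, WithLp.toLp_add, WithLp.toLp_sub,
    Matrix.mul_assoc]
  abel

end ASAP
end
end
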